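/- There exist constants K > 0 and g₀ ≥ 1 such that for every n ≥ 1 and every tuple d = (d_1,…,d_n) with all d_j ≥ 1 for which g(d) is an integer with g(d) ≥ g₀, one has |C(d) − 1/π| ≤ K/g(d). (Uniform large-genus asymptotics C(d) = 1/π + O(1/g(d)) for primitive normalized Witten intersection numbers.) -/

import Mathlib

open scoped BigOperators

noncomputable section

namespace WittenAsym

/-- `g(d)` as a rational number: `g(d) = 1 + (∑ⱼ dⱼ − n)/3`. -/
def gQ (l : List ℕ) : ℚ := 1 + ((l.sum : ℚ) - (l.length : ℚ)) / 3

/-- `X(d)` as a rational number: `X(d) = (∑ⱼ (2dⱼ+1))/3 = 2g(d) − 2 + n`. -/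
def XQ (l : List ℕ) : ℚ := (2 * (l.sum : ℚ) + (l.length : ℚ)) / 3

/-- `X(d)` as a natural number (the correct value whenever `X(d)` is an integer). -/
def XN (l : List ℕ) : ℕ := (2 * l.sum + l.length) / 3

/-- `g(d)` is a nonnegative integer. -/
def IntegralG (l : List ℕ) : Prop := ∃ g : ℕ, (g : ℚ) = gQ l

/-- The subtuple of `r` indexed by the finite index set `I`. -/
def select (r : List ℕ) (I : Finset (Fin r.length)) : List ℕ :=
  ((List.finRange r.length).filter (fun i => i ∈ I)).map r.get

/-- The characterization of the normalized Witten intersection numbers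
`C(d) = 2^{2g(d)} ∏ⱼ (2dⱼ+1)!! / (3^{2g(d)-2+n} (2g(d)-3+n)!) ∫ ψ₁^{d₁}⋯ψₙ^{dₙ}`:
they form the unique family of rationals, symmetric in the entries of `d`, vanishing
when `g(d)` is not a nonnegative integer, with `C(0,0,0) = 1/3`, `C(1) = 1/6`,
and satisfying the DVV recursion whenever `X(d) = 2g(d) - 2 + n ≥ 2`. -/
structure IsNormalizedWitten (C : List ℕ → ℚ) : Prop where
  symm : ∀ {l l' : List ℕ}, l.Perm l' → C l = C l'
  init3 : C [0, 0, 0] = 1/3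
  init1 : C [1] = 1/6
  vanish : ∀ l : List ℕ, ¬ IntegralG l → C l = 0
  dvv : ∀ (d₁ : ℕ) (r : List ℕ), IntegralG (d₁ :: r) → 2 ≤ XQ (d₁ :: r) →
    C (d₁ :: r) =
      (∑ j : Fin r.length,
        if 1 ≤ d₁ + r.get j then
          (2 * (r.get j : ℚ) + 1) / (3 * (XQ (d₁ :: r) - 1)) *
            C (r.set j.val (d₁ + r.get j - 1))
        else 0)
      + ∑ a ∈ Finset.range (d₁ - 1),
          (2 / (3 * (XQ (d₁ :: r) - 1)) * C (a :: (d₁ - 2 - a) :: r)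
          + ∑ I : Finset (Fin r.length),
              if 3 ∣ (2 * (a + (select r I).sum) + (1 + (select r I).length)) then
                ((XN (a :: select r I) - 1).factorial : ℚ) *
                  ((XN ((d₁ - 2 - a) :: select r Iᶜ) - 1).factorial : ℚ) /
                  (6 * ((XN (d₁ :: r) - 1).factorial : ℚ)) *
                  C (a :: select r I) * C ((d₁ - 2 - a) :: select r Iᶜ)
              else 0)

section Helpers

variable {c : List ℕ → ℝ}


/-- total weight `∑ (2 d_j + 1)` -/
def wt (l : List ℕ) : ℕ := 2 * l.sum + l.length

/-- `l` has genus `g` -/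
def Gen (l : List ℕ) (g : ℕ) : Prop := l.sum + 3 = l.length + 3 * g

/-- all ways to pick one entry of a list -/
def picks : List ℕ → List (ℕ × List ℕ)
  | [] => []
  | x :: l => (x, l) :: (picks l).map (fun p => (p.1, x :: p.2))

/-- all ways to split a list into two complementary sublists -/
def splits : List ℕ → List (List ℕ × List ℕ)
  | [] => [([], [])]
  | x :: l => (splits l).map (fun p => (x :: p.1, p.2)) ++ (splits l).map (fun p => (p.1, x :: p.2))

@[simp] lemma wt_nil : wt [] = 0 := rfl
@[simp] lemma wt_cons (x : ℕ) (l : List ℕ) : wt (x :: l) = 2 * x + 1 + wt l := by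
  simp [wt]; ring

lemma integralG_iff (l : List ℕ) : IntegralG l ↔ ∃ g, Gen l g := by
  unfold IntegralG Gen gQ
  constructor
  · rintro ⟨g, hg⟩
    refine ⟨g, ?_⟩
    have : (l.sum : ℚ) + 3 = l.length + 3 * g := by rw [hg]; ring
    exact_mod_cast this
  · rintro ⟨g, hg⟩
    refine ⟨g, ?_⟩
    have : (l.sum : ℚ) + 3 = l.length + 3 * g := by exact_mod_cast hg
    linarith

lemma Gen.wt_eq {l : List ℕ} {g : ℕ} (h : Gen l g) : wt l + 6 = 3 * (2 * g + l.length) := by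
  unfold Gen at h; unfold wt; omega

lemma XN_eq (l : List ℕ) : XN l = wt l / 3 := rfl

lemma XQ_eq {l : List ℕ} {X : ℕ} (h : wt l = 3 * X) : XQ l = X := by
  have h2 : 2 * (l.sum : ℚ) + l.length = 3 * X := by
    unfold wt at h; exact_mod_cast h
  unfold XQ
  rw [h2]; ring

lemma select_cons_zero (x : ℕ) (l : List ℕ) (J : Finset (Fin l.length)) :
    select (x :: l) (insert (0 : Fin (l.length + 1)) (J.map (Fin.succEmb _))) = x :: select l J := by
  unfold select
  have : List.finRange (x :: l).length = 0 :: (List.finRange l.length).map Fin.succ :=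
    List.finRange_succ
  rw [this, List.filter_cons]
  simp [List.filter_map, Function.comp_def]

lemma select_cons_succ (x : ℕ) (l : List ℕ) (J : Finset (Fin l.length)) :
    select (x :: l) (J.map (Fin.succEmb _) : Finset (Fin (l.length + 1))) = select l J := by
  unfold select
  have : List.finRange (x :: l).length = 0 :: (List.finRange l.length).map Fin.succ :=
    List.finRange_succ
  rw [this, List.filter_cons]
  simp [List.filter_map, Function.comp_def]

lemma compl_insert_map {n : ℕ} (J : Finset (Fin n)) :
    (insert (0 : Fin (n + 1)) (J.map (Fin.succEmb _)))ᶜ = Jᶜ.map (Fin.succEmb _) := by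
  ext i
  refine Fin.cases ?_ (fun i => ?_) i <;> simp

lemma compl_map {n : ℕ} (J : Finset (Fin n)) :
    (J.map (Fin.succEmb _) : Finset (Fin (n + 1)))ᶜ = insert 0 (Jᶜ.map (Fin.succEmb _)) := by
  ext i
  refine Fin.cases ?_ (fun i => ?_) i <;> simp

lemma sum_finset_fin_succ {n : ℕ} (f : Finset (Fin (n + 1)) → ℝ) :
    ∑ I, f I = ∑ J : Finset (Fin n), f (insert 0 (J.map (Fin.succEmb _)))
      + ∑ J : Finset (Fin n), f (J.map (Fin.succEmb _)) := by
  have h1 : (Finset.univ : Finset (Finset (Fin (n+1))))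
      = (insert (0 : Fin (n+1)) (Finset.univ.map (Fin.succEmb n))).powerset := by
    ext I
    simp only [Finset.mem_univ, Finset.mem_powerset, true_iff]
    intro i _
    refine Fin.cases ?_ (fun i => ?_) i <;> simp
  rw [h1, Finset.sum_powerset_insert (by simp)]
  have h2 : (Finset.univ.map (Fin.succEmb n)).powerset
      = (Finset.univ : Finset (Finset (Fin n))).map (Finset.mapEmbedding (Fin.succEmb n)).toEmbedding := by
    ext I
    simp only [Finset.mem_powerset, Finset.mem_map, Finset.mem_univ, true_and]
    constructor
    · intro h
      rw [Finset.subset_map_iff] at h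
      obtain ⟨t, _, ht⟩ := h
      exact ⟨t, ht.symm⟩
    · rintro ⟨t, rfl⟩
      change Finset.map _ t ⊆ _
      exact Finset.map_subset_map.2 (Finset.subset_univ _)
  rw [h2, Finset.sum_map, Finset.sum_map, add_comm]
  rfl

lemma sum_select (r : List ℕ) : ∀ F : List ℕ → List ℕ → ℝ,
    ∑ I : Finset (Fin r.length), F (select r I) (select r Iᶜ)
      = ((splits r).map (fun p => F p.1 p.2)).sum := by
  induction r with
  | nil =>
    intro F
    have : (Finset.univ : Finset (Finset (Fin ([] : List ℕ).length))) = {∅} := by decide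
    rw [this]
    simp [splits, select]
  | cons x l ih =>
    intro F
    have := sum_finset_fin_succ (n := l.length)
      (fun I => F (select (x :: l) I) (select (x :: l) Iᶜ))
    refine this.trans ?_
    simp only [compl_insert_map, compl_map]
    have e1 : ∀ J : Finset (Fin l.length),
      F (select (x :: l) (insert (0 : Fin (l.length + 1)) (J.map (Fin.succEmb _))))
        (select (x :: l) (Jᶜ.map (Fin.succEmb _) : Finset (Fin (l.length + 1))))
        = F (x :: select l J) (select l Jᶜ) := fun J => by
      rw [select_cons_zero, select_cons_succ]
    have e2 : ∀ J : Finset (Fin l.length),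
      F (select (x :: l) (J.map (Fin.succEmb _) : Finset (Fin (l.length + 1))))
        (select (x :: l) (insert (0 : Fin (l.length + 1)) (Jᶜ.map (Fin.succEmb _))))
        = F (select l J) (x :: select l Jᶜ) := fun J => by
      rw [select_cons_zero, select_cons_succ]
    rw [Finset.sum_congr rfl (fun J _ => e1 J), Finset.sum_congr rfl (fun J _ => e2 J)]
    rw [ih (fun p q => F (x :: p) q), ih (fun p q => F p (x :: q))]
    simp [splits, Function.comp_def]

lemma sum_picks (r : List ℕ) : ∀ H : ℕ → List ℕ → ℝ,
    ∑ j : Fin r.length, H (r.get j) (r.eraseIdx j.val) = ((picks r).map (fun p => H p.1 p.2)).sum := by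
  induction r with
  | nil => intro H; simp [picks]
  | cons x l ih =>
    intro H
    have := Fin.sum_univ_succ (n := l.length)
      (fun j => H ((x :: l).get j) ((x :: l).eraseIdx j.val))
    refine this.trans ?_
    have h2 := ih (fun e t => H e (x :: t))
    simp only [picks, List.map_cons, List.sum_cons, List.map_map, Function.comp_def]
    rw [← h2]
    simp

lemma splits_prop (r : List ℕ) : ∀ p ∈ splits r, p.1.sum + p.2.sum = r.sum ∧
    p.1.length + p.2.length = r.length ∧ (∀ x ∈ p.1, x ∈ r) ∧ (∀ x ∈ p.2, x ∈ r) := by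
  induction r with
  | nil => simp [splits]
  | cons x l ih =>
    intro p hp
    simp only [splits, List.mem_append, List.mem_map] at hp
    rcases hp with ⟨q, hq, rfl⟩ | ⟨q, hq, rfl⟩
    all_goals
      obtain ⟨h1, h2, h3, h4⟩ := ih q hq
      refine ⟨by simp; omega, by simp; omega, ?_, ?_⟩
      all_goals
        intro y hy
        simp only [List.mem_cons] at hy ⊢
        first
          | (rcases hy with hy | hy
             · exact Or.inl hy
             · first | exact Or.inr (h3 y hy) | exact Or.inr (h4 y hy))
          | exact Or.inr (h3 y hy)
          | exact Or.inr (h4 y hy)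

lemma picks_perm (r : List ℕ) : ∀ p ∈ picks r, List.Perm r (p.1 :: p.2) := by
  induction r with
  | nil => simp [picks]
  | cons x l ih =>
    intro p hp
    simp only [picks, List.mem_cons, List.mem_map] at hp
    rcases hp with rfl | ⟨q, hq, rfl⟩
    · exact List.Perm.refl _
    · exact ((ih q hq).cons x).trans (List.Perm.swap _ _ _)

lemma sum_picks_wt (r : List ℕ) : ((picks r).map (fun p => (2 * (p.1 : ℝ) + 1))).sum = wt r := by
  induction r with
  | nil => simp [picks]
  | cons x l ih =>
    simp only [picks, List.map_cons, List.sum_cons, List.map_map, Function.comp_def, ih, wt_cons]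
    push_cast; ring

lemma list_sum_congr {α : Type*} (L : List α) (f h : α → ℝ) (H : ∀ a ∈ L, f a = h a) :
    (L.map f).sum = (L.map h).sum := by
  rw [List.map_congr_left H]

lemma list_sum_le {α : Type*} (L : List α) (f h : α → ℝ) (H : ∀ a ∈ L, f a ≤ h a) :
    (L.map f).sum ≤ (L.map h).sum := List.sum_le_sum H

lemma list_sum_nonneg {α : Type*} (L : List α) (f : α → ℝ) (H : ∀ a ∈ L, 0 ≤ f a) :
    0 ≤ (L.map f).sum := by
  apply List.sum_nonneg
  simp only [List.mem_map]
  rintro x ⟨a, ha, rfl⟩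
  exact H a ha

lemma list_abs_sum_le {α : Type*} (L : List α) (f : α → ℝ) :
    |(L.map f).sum| ≤ (L.map (fun a => |f a|)).sum := by
  induction L with
  | nil => simp
  | cons a L ih => simp only [List.map_cons, List.sum_cons]; exact (abs_add_le _ _).trans (by linarith)

/-- The convenient real-valued form of the recursion. -/
structure RW (c : List ℕ → ℝ) : Prop where
  symm : ∀ {l l' : List ℕ}, l.Perm l' → c l = c l'
  init3 : c [0, 0, 0] = 1/3
  init1 : c [1] = 1/6
  vanish : ∀ l : List ℕ, (¬ ∃ g, Gen l g) → c l = 0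
  dvv : ∀ (d : ℕ) (r : List ℕ) (X : ℕ), wt (d :: r) = 3 * (X + 2) →
    c (d :: r) =
      1 / (3 * ((X : ℝ) + 1)) *
        (((picks r).map (fun p => (2 * (p.1 : ℝ) + 1) *
            (if 1 ≤ d + p.1 then c ((d + p.1 - 1) :: p.2) else 0))).sum
          + 2 * ∑ a ∈ Finset.range (d - 1), c (a :: (d - 2 - a) :: r))
      + 1 / (6 * ((X + 1).factorial : ℝ)) * ∑ a ∈ Finset.range (d - 1),
          ((splits r).map (fun p => (((wt (a :: p.1) / 3 - 1).factorial : ℝ) * c (a :: p.1)) *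
            (((wt ((d - 2 - a) :: p.2) / 3 - 1).factorial : ℝ) * c ((d - 2 - a) :: p.2)))).sum

lemma gen_of_perm {l l' : List ℕ} (h : l.Perm l') {g : ℕ} (hg : Gen l g) : Gen l' g := by
  unfold Gen at *
  rw [← h.sum_eq, ← h.length_eq]; exact hg

lemma wt_perm {l l' : List ℕ} (h : l.Perm l') : wt l = wt l' := by
  unfold wt; rw [h.sum_eq, h.length_eq]

/-- the recursion when the genus is a nonnegative integer -/
lemma dvv_gen {C : List ℕ → ℚ} (hC : IsNormalizedWitten C) (d : ℕ) (r : List ℕ) (X : ℕ)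
    (hw : wt (d :: r) = 3 * (X + 2)) (hg : ∃ g, Gen (d :: r) g) :
    ((C (d :: r) : ℚ) : ℝ) =
      1 / (3 * ((X : ℝ) + 1)) *
        (((picks r).map (fun p => (2 * (p.1 : ℝ) + 1) *
            (if 1 ≤ d + p.1 then ((C ((d + p.1 - 1) :: p.2) : ℚ) : ℝ) else 0))).sum
          + 2 * ∑ a ∈ Finset.range (d - 1), ((C (a :: (d - 2 - a) :: r) : ℚ) : ℝ))
      + 1 / (6 * ((X + 1).factorial : ℝ)) * ∑ a ∈ Finset.range (d - 1),
          ((splits r).map (fun p => (((wt (a :: p.1) / 3 - 1).factorial : ℝ) * ((C (a :: p.1) : ℚ) : ℝ)) *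
            (((wt ((d - 2 - a) :: p.2) / 3 - 1).factorial : ℝ) *
              ((C ((d - 2 - a) :: p.2) : ℚ) : ℝ)))).sum := by
  have hX : XQ (d :: r) = ((X + 2 : ℕ) : ℚ) := XQ_eq hw
  have h := hC.dvv d r ((integralG_iff _).2 hg) (by rw [hX]; push_cast; linarith [Nat.cast_nonneg (α := ℚ) X])
  have h' : ((C (d :: r) : ℚ) : ℝ) = _ := congrArg (fun q : ℚ => (q : ℝ)) h
  rw [h', hX]
  have hXN : XN (d :: r) - 1 = X + 1 := by rw [XN_eq, hw]; omega
  rw [hXN]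
  rw [Finset.sum_add_distrib]
  have hX1 : (((X + 2 : ℕ) : ℚ) - 1) = ((X + 1 : ℕ) : ℚ) := by push_cast; ring
  rw [hX1]
  have hF : ((X + 1).factorial : ℝ) ≠ 0 := by positivity
  have hX0 : ((X : ℝ) + 1) ≠ 0 := by positivity
  rw [mul_add (1 / (3 * ((X : ℝ) + 1))), Rat.cast_add, Rat.cast_add, add_assoc, Rat.cast_sum,
    Rat.cast_sum, Rat.cast_sum]
  congr 1
  · -- merging terms
    rw [← sum_picks r (fun e t => (2 * (e : ℝ) + 1) *
            (if 1 ≤ d + e then ((C ((d + e - 1) :: t) : ℚ) : ℝ) else 0)), Finset.mul_sum]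
    refine Finset.sum_congr rfl (fun j _ => ?_)
    by_cases hj : 1 ≤ d + r.get j
    · rw [if_pos hj, if_pos hj]
      have : C (r.set j.val (d + r.get j - 1)) = C ((d + r.get j - 1) :: r.eraseIdx j.val) :=
        hC.symm (List.set_perm_cons_eraseIdx j.2 _)
      rw [this]
      push_cast
      field_simp
    · rw [if_neg hj, if_neg hj]; simp
  · congr 1
    · rw [Finset.mul_sum, Finset.mul_sum]
      refine Finset.sum_congr rfl (fun a _ => ?_)
      push_cast
      field_simp
    · rw [Finset.mul_sum]
      refine Finset.sum_congr rfl (fun a ha => ?_)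
      rw [← sum_select r (fun p q => (((wt (a :: p) / 3 - 1).factorial : ℝ) * ((C (a :: p) : ℚ) : ℝ)) *
            (((wt ((d - 2 - a) :: q) / 3 - 1).factorial : ℝ) * ((C ((d - 2 - a) :: q) : ℚ) : ℝ))),
            Finset.mul_sum, Rat.cast_sum]
      refine Finset.sum_congr rfl (fun I _ => ?_)
      split_ifs with hI
      · push_cast
        rw [XN_eq, XN_eq]
        field_simp
      · have : C (a :: select r I) = 0 := by
          apply hC.vanish
          rw [integralG_iff]
          rintro ⟨g, hg⟩
          have := hg.wt_eq
          simp [wt] at this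
          apply hI
          omega
        rw [this]; simp

lemma vanish_gen {C : List ℕ → ℚ} (hC : IsNormalizedWitten C) (l : List ℕ) (h : ¬ ∃ g, Gen l g) :
    ((C l : ℚ) : ℝ) = 0 := by
  rw [hC.vanish l (by rw [integralG_iff]; exact h)]; simp

theorem toRW {C : List ℕ → ℚ} (hC : IsNormalizedWitten C) : RW (fun l => ((C l : ℚ) : ℝ)) where
  symm h := by simp only [hC.symm h]
  init3 := by simp [hC.init3]
  init1 := by simp [hC.init1]
  vanish l h := vanish_gen hC l h
  dvv := by
    intro d r X hw
    by_cases hg : ∃ g, Gen (d :: r) g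
    · exact dvv_gen hC d r X hw hg
    · -- everything vanishes
      rw [vanish_gen hC _ hg]
      have hneg : d + r.sum + 3 < 1 + r.length := by
        by_contra hcon
        apply hg
        refine ⟨(d + r.sum + 3 - (1 + r.length)) / 3, ?_⟩
        simp only [wt, List.sum_cons, List.length_cons] at hw
        simp only [Gen, List.sum_cons, List.length_cons]
        omega
      have e1 : ((picks r).map (fun p => (2 * (p.1 : ℝ) + 1) *
            (if 1 ≤ d + p.1 then ((C ((d + p.1 - 1) :: p.2) : ℚ) : ℝ) else 0))).sum = 0 := by
        apply List.sum_eq_zero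
        simp only [List.mem_map]
        rintro x ⟨p, hp, rfl⟩
        split_ifs with h1
        · rw [vanish_gen hC, mul_zero]
          rintro ⟨g, hg2⟩
          have hs := (picks_perm r p hp).sum_eq
          have hl := (picks_perm r p hp).length_eq
          simp only [Gen, List.sum_cons, List.length_cons] at hg2 hs hl
          omega
        · simp
      have e2 : ∑ a ∈ Finset.range (d - 1), ((C (a :: (d - 2 - a) :: r) : ℚ) : ℝ) = 0 := by
        apply Finset.sum_eq_zero
        intro a ha
        rw [vanish_gen hC]
        rintro ⟨g, hg2⟩
        rw [Finset.mem_range] at ha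
        simp only [Gen, List.sum_cons, List.length_cons] at hg2
        omega
      have e3 : ∑ a ∈ Finset.range (d - 1),
          ((splits r).map (fun p => (((wt (a :: p.1) / 3 - 1).factorial : ℝ) * ((C (a :: p.1) : ℚ) : ℝ)) *
            (((wt ((d - 2 - a) :: p.2) / 3 - 1).factorial : ℝ) *
              ((C ((d - 2 - a) :: p.2) : ℚ) : ℝ)))).sum = 0 := by
        apply Finset.sum_eq_zero
        intro a ha
        rw [Finset.mem_range] at ha
        apply List.sum_eq_zero
        simp only [List.mem_map]
        rintro x ⟨p, hp, rfl⟩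
        obtain ⟨h1, h2, -, -⟩ := splits_prop r p hp
        by_cases hh : ∃ g, Gen (a :: p.1) g
        · have : ((C ((d - 2 - a) :: p.2) : ℚ) : ℝ) = 0 := by
            apply vanish_gen hC
            rintro ⟨g2, hg2⟩
            obtain ⟨g1, hg1⟩ := hh
            simp only [Gen, List.sum_cons, List.length_cons] at hg2 hg1
            omega
          rw [this]; simp
        · rw [vanish_gen hC _ hh]; simp
      rw [e1, e2, e3]; simp




instance (l : List ℕ) (g : ℕ) : Decidable (Gen l g) := by unfold Gen; infer_instance

lemma exists_level {l : List ℕ} (hl : l ≠ []) {g : ℕ} (hg : Gen l g) : ∃ X, wt l = 3 * (X + 1) := by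
  have h := hg.wt_eq
  have hn : 1 ≤ l.length := List.length_pos_iff.2 hl
  unfold Gen at hg
  exact ⟨2 * g + l.length - 3, by omega⟩

lemma level_one {l : List ℕ} (h : wt l = 3) : l = [1] ∨ l = [0, 0, 0] := by
  rcases l with _ | ⟨a, _ | ⟨b, _ | ⟨d, _ | ⟨e, l⟩⟩⟩⟩
  · simp at h
  · left; simp at h; simp; omega
  · simp at h; omega
  · right; simp at h; simp; omega
  · simp at h; omega

lemma perm_of_mem {x : ℕ} {l : List ℕ} (h : x ∈ l) : l.Perm (x :: l.erase x) := List.perm_cons_erase h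

lemma picks_wt {r : List ℕ} {p : ℕ × List ℕ} (hp : p ∈ picks r) : wt r = 2 * p.1 + 1 + wt p.2 := by
  rw [wt_perm (picks_perm r p hp), wt_cons]

lemma splits_wt {r : List ℕ} {p : List ℕ × List ℕ} (hp : p ∈ splits r) : wt r = wt p.1 + wt p.2 := by
  obtain ⟨h1, h2, -, -⟩ := splits_prop r p hp
  unfold wt; omega

lemma picks_mem {r : List ℕ} {p : ℕ × List ℕ} (hp : p ∈ picks r) : p.1 ∈ r ∧ ∀ x ∈ p.2, x ∈ r := by
  have h := picks_perm r p hp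
  refine ⟨h.mem_iff.2 (by simp), fun x hx => h.mem_iff.2 (by simp [hx])⟩

lemma c_nonneg (hc : RW c) : ∀ N : ℕ, ∀ l : List ℕ, wt l ≤ N → l ≠ [] → 0 ≤ c l := by
  intro N
  induction N using Nat.strong_induction_on with
  | _ N ih =>
  intro l hN hl
  by_cases hg : ∃ g, Gen l g
  swap
  · rw [hc.vanish l hg]
  obtain ⟨g, hg⟩ := hg
  obtain ⟨X, hX⟩ := exists_level hl hg
  rcases X with _ | X
  · rcases level_one hX with rfl | rfl
    · rw [hc.init1]; norm_num
    · rw [hc.init3]; norm_num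
  rcases l with _ | ⟨d, r⟩
  · exact absurd rfl hl
  have hw : wt (d :: r) = 3 * (X + 2) := hX
  rw [hc.dvv d r X hw]
  rw [wt_cons] at hw
  have hN' := hN
  rw [wt_cons] at hN'
  have e1 : 0 ≤ ((picks r).map (fun p => (2 * (p.1 : ℝ) + 1) *
            (if 1 ≤ d + p.1 then c ((d + p.1 - 1) :: p.2) else 0))).sum := by
    apply list_sum_nonneg
    intro p hp
    apply mul_nonneg (by positivity)
    split_ifs with h
    · refine ih (N - 1) (by omega) _ ?_ (by simp)
      have := picks_wt hp
      rw [wt_cons]; omega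
    · exact le_refl _
  have e2 : 0 ≤ ∑ a ∈ Finset.range (d - 1), c (a :: (d - 2 - a) :: r) := by
    apply Finset.sum_nonneg
    intro a ha
    rw [Finset.mem_range] at ha
    refine ih (N - 1) (by omega) _ ?_ (by simp)
    rw [wt_cons, wt_cons]; omega
  have e3 : 0 ≤ ∑ a ∈ Finset.range (d - 1),
          ((splits r).map (fun p => (((wt (a :: p.1) / 3 - 1).factorial : ℝ) * c (a :: p.1)) *
            (((wt ((d - 2 - a) :: p.2) / 3 - 1).factorial : ℝ) * c ((d - 2 - a) :: p.2)))).sum := by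
    apply Finset.sum_nonneg
    intro a ha
    rw [Finset.mem_range] at ha
    apply list_sum_nonneg
    intro p hp
    have := splits_wt hp
    apply mul_nonneg
    · apply mul_nonneg (by positivity)
      refine ih (N - 1) (by omega) _ ?_ (by simp)
      rw [wt_cons]; omega
    · apply mul_nonneg (by positivity)
      refine ih (N - 1) (by omega) _ ?_ (by simp)
      rw [wt_cons]; omega
  positivity

lemma RW.nonneg (hc : RW c) {l : List ℕ} (hl : l ≠ []) : 0 ≤ c l := c_nonneg hc _ l le_rfl hl

lemma RW.dilaton (hc : RW c) {r : List ℕ} {X : ℕ} (h : wt r = 3 * (X + 1)) : c (1 :: r) = c r := by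
  have hw : wt (1 :: r) = 3 * (X + 2) := by rw [wt_cons, h]; ring
  rw [hc.dvv 1 r X hw]
  have e1 : ((picks r).map (fun p => (2 * (p.1 : ℝ) + 1) *
            (if 1 ≤ 1 + p.1 then c ((1 + p.1 - 1) :: p.2) else 0))).sum = wt r * c r := by
    rw [← sum_picks_wt, ← List.sum_map_mul_right]
    apply list_sum_congr
    intro p hp
    rw [if_pos (by omega)]
    congr 1
    have : 1 + p.1 - 1 = p.1 := by omega
    rw [this]
    exact hc.symm (picks_perm r p hp).symm
  rw [e1, h]
  simp
  field_simp

/-- zero-count -/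
def nz (l : List ℕ) : ℕ := l.count 0

@[simp] lemma nz_cons_zero (l : List ℕ) : nz (0 :: l) = nz l + 1 := by simp [nz]
lemma nz_cons_pos {x : ℕ} (hx : 1 ≤ x) (l : List ℕ) : nz (x :: l) = nz l := by
  unfold nz; rw [List.count_cons_of_ne (by omega)]
lemma nz_perm {l l' : List ℕ} (h : l.Perm l') : nz l = nz l' := h.count_eq 0
lemma nz_eq_zero {l : List ℕ} : nz l = 0 ↔ ∀ x ∈ l, 1 ≤ x := by
  unfold nz; rw [List.count_eq_zero]
  constructor
  · intro h x hx
    rcases x with _ | x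
    · exact absurd hx h
    · omega
  · intro h h0
    have := h 0 h0
    omega

lemma nz_le_length (l : List ℕ) : nz l ≤ l.length := List.count_le_length

lemma sum_picks_pos (r : List ℕ) :
    ((picks r).map (fun p => (2 * (p.1 : ℝ) + 1) * (if 1 ≤ p.1 then 1 else 0))).sum
      = (wt r : ℝ) - nz r := by
  induction r with
  | nil => simp [picks, nz]
  | cons x l ih =>
    simp only [picks, List.map_cons, List.sum_cons, List.map_map, Function.comp_def, ih, wt_cons]
    rcases x with _ | x
    · simp; ring
    · rw [nz_cons_pos (by omega), if_pos (by omega)]; push_cast; ring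

lemma RW.string (hc : RW c) {r : List ℕ} {X : ℕ} (h : wt (0 :: r) = 3 * (X + 2)) :
    c (0 :: r) = 1 / (3 * ((X : ℝ) + 1)) * ((picks r).map (fun p => (2 * (p.1 : ℝ) + 1) *
            (if 1 ≤ p.1 then c ((p.1 - 1) :: p.2) else 0))).sum := by
  rw [hc.dvv 0 r X h]
  simp

lemma string_weight {r : List ℕ} {X : ℕ} (h : wt (0 :: r) = 3 * (X + 2)) :
    1 / (3 * ((X : ℝ) + 1)) * ((wt r : ℝ) - nz r) = 1 + (2 - (nz r : ℝ)) / (3 * ((X : ℝ) + 1)) := by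
  rw [wt_cons] at h
  have : (wt r : ℝ) = 3 * X + 5 := by
    have h2 : wt r = 3 * X + 5 := by omega
    rw [h2]; push_cast; ring
  rw [this]
  field_simp; ring

lemma RW.string_le (hc : RW c) {r : List ℕ} {X : ℕ} (h : wt (0 :: r) = 3 * (X + 2)) {B : ℝ}
    (hB : ∀ p ∈ picks r, 1 ≤ p.1 → c ((p.1 - 1) :: p.2) ≤ B) :
    c (0 :: r) ≤ (1 + (2 - (nz r : ℝ)) / (3 * ((X : ℝ) + 1))) * B := by
  rw [hc.string h, ← string_weight h, mul_assoc]
  apply mul_le_mul_of_nonneg_left _ (by positivity)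
  rw [← sum_picks_pos, ← List.sum_map_mul_right]
  apply list_sum_le
  intro p hp
  rw [mul_assoc]
  apply mul_le_mul_of_nonneg_left _ (by positivity)
  split_ifs with h1
  · simpa using hB p hp h1
  · simp

lemma sum_splits_len (r : List ℕ) : ∀ h : ℕ → ℝ, ((splits r).map (fun p => h p.1.length)).sum
    = ∑ k ∈ Finset.range (r.length + 1), (r.length.choose k : ℝ) * h k := by
  induction r with
  | nil => intro h; simp [splits]
  | cons x l ih =>
    intro h
    simp only [splits, List.map_append, List.sum_append, List.map_map, Function.comp_def,
      List.length_cons]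
    rw [ih (fun k => h (k + 1)), ih h]
    have := Finset.sum_choose_succ_mul (fun i _ => h i) l.length
    rw [this]; ring

lemma choose_mul_le (a b i j : ℕ) : a.choose i * b.choose j ≤ (a + b).choose (i + j) := by
  rw [Nat.add_choose_eq]
  exact Finset.single_le_sum (f := fun ij : ℕ × ℕ => a.choose ij.1 * b.choose ij.2)
    (fun _ _ => Nat.zero_le _) (a := (i, j)) (by simp)

lemma le_choose (G : ℕ) : ∀ i, 1 ≤ i → i + 1 ≤ G → G ≤ G.choose i := by
  induction G with
  | zero => intro i h1 h2; omega
  | succ G ih =>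
    intro i h1 h2
    rcases i with _ | i
    · omega
    rw [Nat.choose_succ_succ']
    by_cases hi : i + 1 + 1 ≤ G
    · have := ih (i + 1) (by omega) hi
      have h3 : 1 ≤ G.choose i := Nat.choose_pos (by omega)
      omega
    · have h4 : i + 1 = G := by omega
      subst h4
      simp

lemma sq_le_choose (G i : ℕ) (h1 : 1 ≤ i) (h2 : i + 1 ≤ G) : G ^ 2 ≤ (2 * G).choose (2 * i) := by
  have h := choose_mul_le G G i i
  have h3 := le_choose G i h1 h2
  rw [two_mul, two_mul, sq]
  exact (Nat.mul_le_mul h3 h3).trans h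

/-- number of admissible `k` -/
def cnt (m G i : ℕ) : ℕ := ((Finset.range (m + 1)).filter (fun k => k ≤ 3 * i + 1 ∧ m ≤ k + 3 * (G - i) + 1)).card

lemma cnt_le1 (m G i : ℕ) : cnt m G i ≤ 3 * i + 2 := by
  unfold cnt
  calc _ ≤ (Finset.range (3 * i + 2)).card := by
        apply Finset.card_le_card
        intro k hk
        simp only [Finset.mem_filter, Finset.mem_range] at *
        omega
    _ = _ := by simp

lemma cnt_le2 (m G i : ℕ) : cnt m G i ≤ 3 * (G - i) + 2 := by
  unfold cnt
  calc _ ≤ (Finset.Icc (m - 3 * (G - i) - 1) m).card := by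
        apply Finset.card_le_card
        intro k hk
        simp only [Finset.mem_filter, Finset.mem_range, Finset.mem_Icc] at *
        omega
    _ ≤ _ := by simp; omega

lemma sum_cnt (m G : ℕ) : ∑ i ∈ Finset.range (G + 1), (cnt m G i : ℝ) / ((2 * G).choose (2 * i) : ℝ) ≤ 6 := by
  rcases Nat.eq_zero_or_pos G with rfl | hGpos
  · have c1 : (cnt m 0 0 : ℝ) ≤ 3 * (0 : ℕ) + 2 := by exact_mod_cast cnt_le1 m 0 0
    simp only [zero_add, Finset.sum_range_one]
    norm_num at c1 ⊢
    have : (cnt m 0 0 : ℝ) ≤ 2 := by exact_mod_cast c1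
    linarith
  set t : ℝ := (3 / 2 * G + 2) / G ^ 2 with ht
  have hG1 : (1 : ℝ) ≤ G := by exact_mod_cast hGpos
  have hterm : ∀ i ∈ Finset.range (G + 1), (cnt m G i : ℝ) / ((2 * G).choose (2 * i) : ℝ)
      ≤ (if i = 0 then 2 - t else 0) + (if i = G then 2 - t else 0) + t := by
    intro i hi
    rw [Finset.mem_range] at hi
    have c1 : (cnt m G i : ℝ) ≤ 3 * i + 2 := by exact_mod_cast cnt_le1 m G i
    have c2 : (cnt m G i : ℝ) ≤ 3 * (G - i : ℕ) + 2 := by exact_mod_cast cnt_le2 m G i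
    rw [Nat.cast_sub (by omega)] at c2
    by_cases h0 : i = 0
    · subst h0
      rw [if_pos rfl, if_neg (by omega)]
      rw [Nat.cast_zero] at c1
      rw [mul_zero, Nat.choose_zero_right, Nat.cast_one]
      linarith
    by_cases h1 : i = G
    · subst h1
      rw [if_pos rfl, if_neg (by omega), Nat.choose_self, Nat.cast_one]
      linarith
    · rw [if_neg h0, if_neg h1]
      have hs : ((G : ℝ)) ^ 2 ≤ ((2 * G).choose (2 * i) : ℝ) := by
        exact_mod_cast sq_le_choose G i (by omega) (by omega)
      have hG2 : (0 : ℝ) < (G : ℝ) ^ 2 := by positivity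
      rw [zero_add, zero_add, ht]
      apply div_le_div₀ (by positivity) (by linarith) hG2 hs
  refine (Finset.sum_le_sum hterm).trans ?_
  rw [Finset.sum_add_distrib, Finset.sum_add_distrib]
  have e1 : ∑ i ∈ Finset.range (G + 1), (if i = 0 then 2 - t else 0) = 2 - t := by simp
  have e2 : ∑ i ∈ Finset.range (G + 1), (if i = G then 2 - t else 0) = 2 - t := by simp
  have e3 : ∑ i ∈ Finset.range (G + 1), t = (G + 1) * t := by simp
  rw [e1, e2, e3]
  have : (G - 1) * t ≤ 2 := by
    rw [ht, ← mul_div_assoc, div_le_iff₀ (by positivity)]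
    nlinarith
  linarith

/-- The product terms in the recursion. -/
def prodT (c : List ℕ → ℝ) (d : ℕ) (r : List ℕ) (X : ℕ) : ℝ :=
  1 / (6 * ((X + 1).factorial : ℝ)) * ∑ a ∈ Finset.range (d - 1),
          ((splits r).map (fun p => (((wt (a :: p.1) / 3 - 1).factorial : ℝ) * c (a :: p.1)) *
            (((wt ((d - 2 - a) :: p.2) / 3 - 1).factorial : ℝ) * c ((d - 2 - a) :: p.2)))).sum

lemma prodT_nonneg (hc : RW c) (d : ℕ) (r : List ℕ) (X : ℕ) : 0 ≤ prodT c d r X := by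
  unfold prodT
  apply mul_nonneg (by positivity)
  apply Finset.sum_nonneg
  intro a ha
  apply list_sum_nonneg
  intro p hp
  have h1 := hc.nonneg (l := a :: p.1) (by simp)
  have h2 := hc.nonneg (l := (d - 2 - a) :: p.2) (by simp)
  positivity

lemma two_mul_len_le {p : List ℕ} (h : ∀ x ∈ p, 2 ≤ x) : 2 * p.length ≤ p.sum := by
  induction p with
  | nil => simp
  | cons x p ih =>
    have h1 := h x (by simp)
    have h2 := ih (fun y hy => h y (by simp [hy]))
    simp only [List.length_cons, List.sum_cons]; omega

lemma term_bound (hc : RW c) {a b : ℕ} {r : List ℕ} {X G : ℕ} {V : ℝ} (hV : 0 ≤ V)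
    (hG : a + b + r.sum + 5 = r.length + 1 + 3 * (G + 2)) (hX : X = 2 * G + 1 + r.length)
    (hr : ∀ x ∈ r, 2 ≤ x) (p : List ℕ × List ℕ) (hp : p ∈ splits r)
    (h1 : c (a :: p.1) ≤ V) (h2 : c (b :: p.2) ≤ V) :
    1 / ((X + 1).factorial : ℝ) * ((((wt (a :: p.1) / 3 - 1).factorial : ℝ) * c (a :: p.1)) *
            (((wt (b :: p.2) / 3 - 1).factorial : ℝ) * c (b :: p.2)))
    ≤ V ^ 2 / (((X : ℝ) + 1) * X) * ∑ i ∈ Finset.range (G + 1),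
      (if Gen (a :: p.1) (i + 1) then 1 else 0) *
      ((if p.1.length ≤ 3 * i + 1 ∧ r.length ≤ p.1.length + 3 * (G - i) + 1 then
        1 / (r.length.choose p.1.length : ℝ) else 0) / ((2 * G).choose (2 * i) : ℝ)) := by
  have hX1 : (1 : ℝ) ≤ X := by exact_mod_cast (by omega : 1 ≤ X)
  have n1 := hc.nonneg (l := a :: p.1) (by simp)
  have n2 := hc.nonneg (l := b :: p.2) (by simp)
  obtain ⟨s1, s2, s3, s4⟩ := splits_prop r p hp
  have t1 := two_mul_len_le (fun x hx => hr x (s3 x hx))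
  have t2 := two_mul_len_le (fun x hx => hr x (s4 x hx))
  have hnn : ∀ i ∈ Finset.range (G + 1), (0 : ℝ) ≤ (if Gen (a :: p.1) (i + 1) then 1 else 0) *
      ((if p.1.length ≤ 3 * i + 1 ∧ r.length ≤ p.1.length + 3 * (G - i) + 1 then
        1 / (r.length.choose p.1.length : ℝ) else 0) / ((2 * G).choose (2 * i) : ℝ)) := by
    intro i _
    apply mul_nonneg
    · split_ifs <;> norm_num
    · apply div_nonneg _ (by positivity)
      split_ifs
      · positivity
      · exact le_refl _
  have hR : 0 ≤ V ^ 2 / (((X : ℝ) + 1) * X) := by positivity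
  by_cases g1 : ∃ g, Gen (a :: p.1) g
  swap
  · rw [hc.vanish _ g1]
    simp only [mul_zero, zero_mul]
    exact mul_nonneg hR (Finset.sum_nonneg hnn)
  by_cases g2 : ∃ g, Gen (b :: p.2) g
  swap
  · rw [hc.vanish _ g2]
    simp only [mul_zero]
    exact mul_nonneg hR (Finset.sum_nonneg hnn)
  obtain ⟨g1, hg1⟩ := g1
  obtain ⟨g2, hg2⟩ := g2
  have w1 := hg1.wt_eq
  have w2 := hg2.wt_eq
  have hg1' := hg1
  have hg2' := hg2
  unfold Gen at hg1' hg2'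
  simp only [List.length_cons, List.sum_cons] at w1 w2 hg1' hg2'
  obtain ⟨i, rfl⟩ : ∃ i, g1 = i + 1 := ⟨g1 - 1, by omega⟩
  obtain ⟨j, rfl⟩ : ∃ j, g2 = j + 1 := ⟨g2 - 1, by omega⟩
  have hij : i + j = G := by omega
  have e1 : wt (a :: p.1) / 3 - 1 = 2 * i + p.1.length := by omega
  have e2 : wt (b :: p.2) / 3 - 1 = 2 * j + p.2.length := by omega
  rw [e1, e2]
  refine le_trans ?_ (mul_le_mul_of_nonneg_left (Finset.single_le_sum hnn (a := i) (by simp; omega)) hR)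
  rw [if_pos hg1, if_pos ⟨by omega, by omega⟩, one_mul]
  obtain ⟨Y, rfl⟩ : ∃ Y, X = Y + 1 := ⟨X - 1, by omega⟩
  set P := 2 * i + p.1.length
  set Q := 2 * j + p.2.length
  have hPQ : Y = P + Q := by omega
  have hch : (2 * G).choose (2 * i) * r.length.choose p.1.length ≤ Y.choose P := by
    have := choose_mul_le (2 * G) r.length (2 * i) p.1.length
    have e : 2 * G + r.length = Y := by omega
    rwa [e] at this
  have hfac : Y.choose P * P.factorial * Q.factorial = Y.factorial := by
    have h3 := Nat.choose_mul_factorial_mul_factorial (n := Y) (k := P) (by omega)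
    have h4 : Y - P = Q := by omega
    rwa [h4] at h3
  have hfac2 : (Y + 1 + 1).factorial = (Y + 2) * ((Y + 1) * Y.factorial) := by
    rw [Nat.factorial_succ, Nat.factorial_succ]
  rw [hfac2, ← hfac]
  push_cast
  have p1 : (0 : ℝ) < (Y.choose P : ℝ) := by exact_mod_cast Nat.choose_pos (by omega)
  have p2 : (0 : ℝ) < (P.factorial : ℝ) := by positivity
  have p3 : (0 : ℝ) < (Q.factorial : ℝ) := by positivity
  have p4 : (0 : ℝ) < ((2 * G).choose (2 * i) : ℝ) := by exact_mod_cast Nat.choose_pos (by omega)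
  have p5 : (0 : ℝ) < (r.length.choose p.1.length : ℝ) := by exact_mod_cast Nat.choose_pos (by omega)
  have hch' : ((2 * G).choose (2 * i) : ℝ) * (r.length.choose p.1.length : ℝ) ≤ (Y.choose P : ℝ) := by
    exact_mod_cast hch
  have L : 1 / (((Y : ℝ) + 2) * ((Y + 1) * ((Y.choose P : ℝ) * P.factorial * Q.factorial))) *
      (P.factorial * c (a :: p.1) * (Q.factorial * c (b :: p.2)))
      = (c (a :: p.1) * c (b :: p.2)) / (((Y : ℝ) + 2) * (Y + 1)) * (1 / (Y.choose P : ℝ)) := by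
    field_simp
  rw [L]
  have e5 : ((Y : ℝ) + 1 + 1) = Y + 2 := by ring
  rw [e5]
  apply mul_le_mul
  · apply div_le_div_of_nonneg_right _ (by positivity)
    nlinarith
  · rw [div_div, mul_comm (r.length.choose p.1.length : ℝ)]
    exact one_div_le_one_div_of_le (by positivity) hch'
  · positivity
  · positivity

lemma prodT_le (hc : RW c) {d : ℕ} {r : List ℕ} {X G : ℕ} {V : ℝ} (hV : 0 ≤ V)
    (hg : Gen (d :: r) (G + 2)) (hw : wt (d :: r) = 3 * (X + 2))
    (hr : ∀ x ∈ r, 2 ≤ x)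
    (hb : ∀ a p, (∀ x ∈ p, 2 ≤ x) → wt (a :: p) < 3 * (X + 1) → c (a :: p) ≤ V) :
    prodT c d r X ≤ V ^ 2 / (((X : ℝ) + 1) * X) := by
  have hw2 := hg.wt_eq
  rw [hw] at hw2
  simp only [List.length_cons] at hw2
  have hXe : X = 2 * G + 1 + r.length := by omega
  have hX1 : (1 : ℝ) ≤ X := by exact_mod_cast (by omega : 1 ≤ X)
  have hV2 : 0 ≤ V ^ 2 / (((X : ℝ) + 1) * X) := by positivity
  have hg' := hg
  unfold Gen at hg'
  simp only [List.length_cons, List.sum_cons] at hg'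
  rw [wt_cons] at hw
  have step : ∀ a ∈ Finset.range (d - 1), 1 / ((X + 1).factorial : ℝ) *
      ((splits r).map (fun p => (((wt (a :: p.1) / 3 - 1).factorial : ℝ) * c (a :: p.1)) *
            (((wt ((d - 2 - a) :: p.2) / 3 - 1).factorial : ℝ) * c ((d - 2 - a) :: p.2)))).sum
      ≤ ((splits r).map (fun p => V ^ 2 / (((X : ℝ) + 1) * X) * ∑ i ∈ Finset.range (G + 1),
      (if Gen (a :: p.1) (i + 1) then 1 else 0) *
      ((if p.1.length ≤ 3 * i + 1 ∧ r.length ≤ p.1.length + 3 * (G - i) + 1 then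
        1 / (r.length.choose p.1.length : ℝ) else 0) / ((2 * G).choose (2 * i) : ℝ)))).sum := by
    intro a ha
    rw [Finset.mem_range] at ha
    rw [← List.sum_map_mul_left]
    apply list_sum_le
    intro p hp
    obtain ⟨s1, s2, s3, s4⟩ := splits_prop r p hp
    have sw := splits_wt hp
    apply term_bound hc hV (by omega) hXe hr p hp
    · exact hb a p.1 (fun x hx => hr x (s3 x hx)) (by rw [wt_cons]; omega)
    · exact hb _ p.2 (fun x hx => hr x (s4 x hx)) (by rw [wt_cons]; omega)
  have hsum := Finset.sum_le_sum step
  rw [← Finset.mul_sum] at hsum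
  have e0 : prodT c d r X = 1 / 6 * (1 / ((X + 1).factorial : ℝ) * ∑ a ∈ Finset.range (d - 1),
      ((splits r).map (fun p => (((wt (a :: p.1) / 3 - 1).factorial : ℝ) * c (a :: p.1)) *
            (((wt ((d - 2 - a) :: p.2) / 3 - 1).factorial : ℝ) * c ((d - 2 - a) :: p.2)))).sum) := by
    unfold prodT
    rw [← mul_assoc]
    congr 1
    field_simp
  rw [e0]
  have swap : ∑ a ∈ Finset.range (d - 1), ((splits r).map (fun p => V ^ 2 / (((X : ℝ) + 1) * X) *
      ∑ i ∈ Finset.range (G + 1),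
      (if Gen (a :: p.1) (i + 1) then 1 else 0) *
      ((if p.1.length ≤ 3 * i + 1 ∧ r.length ≤ p.1.length + 3 * (G - i) + 1 then
        1 / (r.length.choose p.1.length : ℝ) else 0) / ((2 * G).choose (2 * i) : ℝ)))).sum
      ≤ ((splits r).map (fun p => V ^ 2 / (((X : ℝ) + 1) * X) * ∑ i ∈ Finset.range (G + 1),
      ((if p.1.length ≤ 3 * i + 1 ∧ r.length ≤ p.1.length + 3 * (G - i) + 1 then
        1 / (r.length.choose p.1.length : ℝ) else 0) / ((2 * G).choose (2 * i) : ℝ)))).sum := by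
    have e : ∀ (f : ℕ → List ℕ × List ℕ → ℝ) (L : List (List ℕ × List ℕ)) (s : Finset ℕ),
        ∑ a ∈ s, (L.map (f a)).sum = (L.map (fun p => ∑ a ∈ s, f a p)).sum := by
      intro f L s
      induction L with
      | nil => simp
      | cons x L ih => simp [Finset.sum_add_distrib, ih]
    rw [e]
    apply list_sum_le
    intro p hp
    rw [← Finset.mul_sum]
    apply mul_le_mul_of_nonneg_left _ hV2
    rw [Finset.sum_comm]
    apply Finset.sum_le_sum
    intro i hi
    rw [← Finset.sum_mul]
    apply mul_le_of_le_one_left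
    · apply div_nonneg _ (by positivity)
      split_ifs
      · positivity
      · exact le_refl _
    · rw [Finset.sum_boole]
      norm_cast
      apply Finset.card_le_one.2
      intro x hx y hy
      have hx2 := (Finset.mem_filter.1 hx).2
      have hy2 := (Finset.mem_filter.1 hy).2
      simp only [Gen, List.sum_cons, List.length_cons] at hx2 hy2
      omega
  have last : ((splits r).map (fun p => V ^ 2 / (((X : ℝ) + 1) * X) * ∑ i ∈ Finset.range (G + 1),
      ((if p.1.length ≤ 3 * i + 1 ∧ r.length ≤ p.1.length + 3 * (G - i) + 1 then
        1 / (r.length.choose p.1.length : ℝ) else 0) / ((2 * G).choose (2 * i) : ℝ)))).sum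
      = V ^ 2 / (((X : ℝ) + 1) * X) * ∑ i ∈ Finset.range (G + 1),
        (cnt r.length G i : ℝ) / ((2 * G).choose (2 * i) : ℝ) := by
    rw [List.sum_map_mul_left]
    congr 1
    rw [sum_splits_len r (fun k => ∑ i ∈ Finset.range (G + 1),
      ((if k ≤ 3 * i + 1 ∧ r.length ≤ k + 3 * (G - i) + 1 then
        1 / (r.length.choose k : ℝ) else 0) / ((2 * G).choose (2 * i) : ℝ)))]
    simp only [Finset.mul_sum]
    rw [Finset.sum_comm]
    apply Finset.sum_congr rfl
    intro i _
    unfold cnt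
    rw [Finset.card_filter]
    push_cast
    rw [Finset.sum_div]
    apply Finset.sum_congr rfl
    intro k hk
    rw [Finset.mem_range] at hk
    have : (r.length.choose k : ℝ) ≠ 0 := by
      have := Nat.choose_pos (n := r.length) (k := k) (by omega)
      positivity
    split_ifs
    · field_simp
    · simp
  have fin := mul_le_mul_of_nonneg_left (sum_cnt r.length G) hV2
  linarith




/-- supersolution -/
def uu (X : ℕ) : ℝ := if X ≤ 1 then 1 / 6 else 5 * ((X : ℝ) - 1) / (5 * X + 14)

def ww (s : ℕ) : ℝ := (1 + 2 / (3 * (s : ℝ))) * uu s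

lemma uu_one : uu 1 = 1 / 6 := by simp [uu]
lemma uu_ge2 (X : ℕ) : uu (X + 2) = 5 * ((X : ℝ) + 1) / (5 * X + 24) := by
  unfold uu; rw [if_neg (by omega)]; push_cast; congr 1 <;> ring

lemma uu_mono_succ (X : ℕ) : uu X ≤ uu (X + 1) := by
  rcases X with _ | _ | X
  · simp [uu]
  · rw [uu_ge2 0]; simp [uu]; norm_num
  · rw [uu_ge2, uu_ge2 (X + 1)]
    push_cast
    rw [div_le_div_iff₀ (by positivity) (by positivity)]
    nlinarith [Nat.cast_nonneg (α := ℝ) X]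

lemma uu_mono {X Y : ℕ} (h : X ≤ Y) : uu X ≤ uu Y := monotone_nat_of_le_succ uu_mono_succ h

lemma uu_pos (X : ℕ) : 0 < uu X := by
  have := uu_mono (Nat.zero_le X)
  have h0 : uu 0 = 1 / 6 := by simp [uu]
  rw [h0] at this; linarith

lemma uu_le_one (X : ℕ) : uu X ≤ 1 := by
  have := uu_mono (show X ≤ X + 2 by omega)
  rw [uu_ge2] at this
  refine this.trans ?_
  rw [div_le_one (by positivity)]
  linarith

lemma ww_mono_succ (s : ℕ) : ww (s + 1) ≤ ww (s + 2) := by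
  unfold ww
  rcases s with _ | s
  · rw [uu_ge2 0]; norm_num [uu]
  · rw [uu_ge2, uu_ge2 (s + 1)]
    push_cast
    have h1 : (1 + 2 / (3 * ((s : ℝ) + 1 + 1))) * (5 * ((s : ℝ) + 1) / (5 * s + 24))
      = ((3 * s + 8) * (5 * (s + 1))) / (3 * (s + 2) * (5 * s + 24)) := by field_simp; ring
    have h2 : (1 + 2 / (3 * ((s : ℝ) + 1 + 2))) * (5 * ((s : ℝ) + 1 + 1) / (5 * (s + 1) + 24))
      = ((3 * s + 11) * (5 * (s + 2))) / (3 * (s + 3) * (5 * s + 29)) := by field_simp; ring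
    rw [h1, h2, div_le_div_iff₀ (by positivity) (by positivity)]
    have hs : (0 : ℝ) ≤ s := Nat.cast_nonneg s
    have p2 : 0 ≤ (s : ℝ) ^ 2 := by positivity
    have p3 : 0 ≤ (s : ℝ) ^ 3 := by positivity
    have p4 : 0 ≤ (s : ℝ) ^ 4 := by positivity
    nlinarith

lemma ww_mono {s t : ℕ} (h1 : 1 ≤ s) (h : s ≤ t) : ww s ≤ ww t := by
  obtain ⟨s, rfl⟩ : ∃ k, s = k + 1 := ⟨s - 1, by omega⟩
  obtain ⟨t, rfl⟩ : ∃ k, t = k + 1 := ⟨t - 1, by omega⟩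
  exact monotone_nat_of_le_succ (f := fun k => ww (k + 1)) ww_mono_succ (by omega : s ≤ t)

lemma uu_le_ww (s : ℕ) : uu s ≤ ww s := by
  unfold ww
  have := uu_pos s
  have h : 0 ≤ 2 / (3 * (s : ℝ)) := by positivity
  nlinarith

lemma ww_le_one (s : ℕ) (h : 1 ≤ s) : ww s ≤ 1 := by
  rcases s with _ | _ | s
  · omega
  · unfold ww; norm_num [uu]
  · unfold ww
    rw [uu_ge2]
    push_cast
    have h1 : (1 + 2 / (3 * ((s : ℝ) + 2))) * (5 * ((s : ℝ) + 1) / (5 * s + 24))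
      = ((3 * s + 8) * (5 * (s + 1))) / (3 * (s + 2) * (5 * s + 24)) := by field_simp; ring
    have e : ((s : ℝ) + 1 + 1) = s + 2 := by ring
    rw [e, h1, div_le_one (by positivity)]
    nlinarith [Nat.cast_nonneg (α := ℝ) s]

lemma ww_sq (X : ℕ) (h : 1 ≤ X) :
    uu (X + 1) * (1 + 8 / 9 / (((X : ℝ) + 1) * X)) + (ww X) ^ 2 / (((X : ℝ) + 1) * X) ≤ uu (X + 2) := by
  rcases X with _ | _ | X
  · omega
  · unfold ww; rw [uu_ge2 1, uu_ge2 0]; norm_num [uu]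
  · have hw : ww (X + 2) ≤ 4 / 3 * uu (X + 3) := by
      unfold ww
      have h1 : (1 + 2 / (3 * ((X + 2 : ℕ) : ℝ))) ≤ 4 / 3 := by
        have : 2 / (3 * ((X + 2 : ℕ) : ℝ)) ≤ 1 / 3 := by
          rw [div_le_div_iff₀ (by positivity) (by norm_num)]; push_cast
          nlinarith [Nat.cast_nonneg (α := ℝ) X]
        linarith
      have h2 := uu_mono_succ (X + 2)
      have h3 := uu_pos (X + 2)
      nlinarith
    have hw0 : 0 ≤ ww (X + 2) := (uu_pos _).le.trans (uu_le_ww _)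
    have hsq : (ww (X + 2)) ^ 2 ≤ 16 / 9 * (uu (X + 3)) ^ 2 := by nlinarith
    have e1 : uu (X + 3) = 5 * ((X : ℝ) + 2) / (5 * X + 29) := by
      rw [uu_ge2 (X + 1)]; push_cast; congr 1 <;> ring
    have e2 : uu (X + 4) = 5 * ((X : ℝ) + 3) / (5 * X + 34) := by
      rw [uu_ge2 (X + 2)]; push_cast; congr 1 <;> ring
    change uu (X + 3) * (1 + 8 / 9 / ((((X + 2 : ℕ) : ℝ) + 1) * (X + 2 : ℕ))) + _ ≤ uu (X + 4)
    have hs : (0 : ℝ) ≤ X := Nat.cast_nonneg X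
    have hq : (ww (X + 2)) ^ 2 / ((((X + 2 : ℕ) : ℝ) + 1) * (X + 2 : ℕ))
       ≤ 16 / 9 * (uu (X + 3)) ^ 2 / ((((X + 2 : ℕ) : ℝ) + 1) * (X + 2 : ℕ)) :=
      div_le_div_of_nonneg_right hsq (by positivity)
    refine (add_le_add_right hq _).trans ?_
    rw [e1, e2]
    push_cast
    have lhs : 5 * ((X : ℝ) + 2) / (5 * X + 29) * (1 + 8 / 9 / (((X : ℝ) + 2 + 1) * (X + 2)))
      + 16 / 9 * (5 * ((X : ℝ) + 2) / (5 * X + 29)) ^ 2 / (((X : ℝ) + 2 + 1) * (X + 2))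
      = (45 * (X + 2) * (X + 3) * (5 * X + 29) + 40 * (5 * X + 29) + 400 * (X + 2))
        / (9 * (X + 3) * (5 * X + 29) ^ 2) := by
      have : (X : ℝ) + 2 + 1 = X + 3 := by ring
      rw [this]
      field_simp; ring
    rw [lhs, div_le_div_iff₀ (by positivity) (by positivity)]
    have p2 : 0 ≤ (X : ℝ) ^ 2 := by positivity
    have p3 : 0 ≤ (X : ℝ) ^ 3 := by positivity
    have p4 : 0 ≤ (X : ℝ) ^ 4 := by positivity
    nlinarith

/-- positive lists of level at most `L` are bounded -/
def PB (c : List ℕ → ℝ) (L : ℕ) : Prop :=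
  ∀ l : List ℕ, ∀ X, l ≠ [] → (∀ x ∈ l, 1 ≤ x) → wt l = 3 * X → X ≤ L → c l ≤ uu X

lemma two_le_of_not_mem {l : List ℕ} (h : ∀ x ∈ l, 1 ≤ x) (h1 : 1 ∉ l) : ∀ x ∈ l, 2 ≤ x := by
  intro x hx
  have := h x hx
  have : x ≠ 1 := by rintro rfl; exact h1 hx
  omega

lemma Zone (hc : RW c) {L : ℕ} (hP : PB c L) : ∀ Y : ℕ, ∀ s : List ℕ, (∀ x ∈ s, 1 ≤ x) →
    wt (0 :: s) = 3 * (Y + 2) → Y + 1 ≤ L → c (0 :: s) ≤ ww (Y + 1) := by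
  intro Y
  induction Y with
  | zero =>
    intro s hs hw hL
    by_cases h1 : 1 ∈ s
    · exfalso
      have hp := perm_of_mem h1
      have := wt_perm hp
      simp only [wt_cons] at this hw
      have h3 : wt (s.erase 1) = 2 := by omega
      have hs' : ∀ x ∈ s.erase 1, 1 ≤ x := fun x hx => hs x (List.mem_of_mem_erase hx)
      rcases h : s.erase 1 with _ | ⟨a, t⟩
      · rw [h] at h3; simp at h3
      · rw [h] at h3 hs'
        have := hs' a (by simp)
        simp at h3; omega
    · have h2 := two_le_of_not_mem hs h1
      have h := hc.string_le (B := uu 1) hw (by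
        intro p hp hp1
        have hm := picks_mem hp
        have hpw := picks_wt hp
        refine hP _ 1 (by simp) ?_ (by simp only [wt_cons] at *; omega) hL
        intro x hx
        rcases List.mem_cons.1 hx with rfl | hx
        · have := h2 _ hm.1; omega
        · exact hs x (hm.2 x hx))
      rw [nz_eq_zero.2 hs] at h
      unfold ww
      simpa using h
  | succ Y ih =>
    intro s hs hw hL
    by_cases h1 : 1 ∈ s
    · have hp := perm_of_mem h1
      have hw1 := wt_perm hp
      have hs' : ∀ x ∈ s.erase 1, 1 ≤ x := fun x hx => hs x (List.mem_of_mem_erase hx)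
      have hw' : wt (0 :: s.erase 1) = 3 * (Y + 2) := by
        simp only [wt_cons] at *; omega
      have h := ih (s.erase 1) hs' hw' (by omega)
      have e : c (0 :: s) = c (0 :: s.erase 1) := by
        rw [← hc.dilaton (X := Y + 1) hw']
        exact hc.symm ((hp.cons 0).trans (List.Perm.swap _ _ _))
      rw [e]
      exact h.trans (ww_mono_succ Y)
    · have h2 := two_le_of_not_mem hs h1
      have h := hc.string_le (B := uu (Y + 2)) hw (by
        intro p hp hp1
        have hm := picks_mem hp
        have hpw := picks_wt hp
        refine hP _ (Y + 2) (by simp) ?_ (by simp only [wt_cons] at *; omega) (by omega)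
        intro x hx
        rcases List.mem_cons.1 hx with rfl | hx
        · have := h2 _ hm.1; omega
        · exact hs x (hm.2 x hx))
      rw [nz_eq_zero.2 hs] at h
      unfold ww
      simpa [add_assoc, one_add_one_eq_two] using h

lemma Ztwo (hc : RW c) {L : ℕ} (hP : PB c L) (Y : ℕ) (s : List ℕ) (hs : ∀ x ∈ s, 2 ≤ x)
    (hw : wt (0 :: 0 :: s) = 3 * (Y + 2)) (hL : Y ≤ L) :
    1 ≤ Y ∧ c (0 :: 0 :: s) ≤ (1 + 1 / (3 * ((Y : ℝ) + 1))) * ww Y := by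
  have hY : 1 ≤ Y := by
    simp only [wt_cons] at hw
    rcases s with _ | ⟨a, t⟩
    · simp at hw; omega
    · have := hs a (by simp)
      simp at hw; omega
  refine ⟨hY, ?_⟩
  have h := hc.string_le (B := ww Y) hw (by
    intro p hp hp1
    simp only [picks, List.mem_cons, List.mem_map] at hp
    rcases hp with rfl | ⟨q, hq, rfl⟩
    · simp at hp1
    · have hm := picks_mem hq
      have hpw := picks_wt hq
      simp only at hp1 ⊢
      rw [hc.symm (List.Perm.swap 0 (q.1 - 1) q.2)]
      obtain ⟨y, rfl⟩ : ∃ y, Y = y + 1 := ⟨Y - 1, by omega⟩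
      refine Zone hc hP y _ ?_ (by simp only [wt_cons] at *; omega) hL
      intro x hx
      rcases List.mem_cons.1 hx with rfl | hx
      · have := hs _ hm.1; omega
      · have := hs x (hm.2 x hx); omega)
  rw [nz_cons_zero, nz_eq_zero.2 (fun x hx => (by have := hs x hx; omega : 1 ≤ x))] at h
  norm_num at h ⊢
  exact h

lemma split_sum_le (hc : RW c) {X d : ℕ} {r : List ℕ} (hP : PB c (X + 1)) (hX : 1 ≤ X)
    (hd : 2 ≤ d) (hr : ∀ x ∈ r, 2 ≤ x) (hw : wt (d :: r) = 3 * (X + 2)) :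
    ∑ a ∈ Finset.range (d - 1), c (a :: (d - 2 - a) :: r)
      ≤ ((d : ℝ) - 1) * uu (X + 1) + 4 / (3 * (X : ℝ)) * uu (X + 1) := by
  have hXr : (1 : ℝ) ≤ X := by exact_mod_cast hX
  have hU := uu_pos (X + 1)
  have hr1 : ∀ x ∈ r, 1 ≤ x := fun x hx => by have := hr x hx; omega
  have hwX : ww X ≤ (1 + 2 / (3 * (X : ℝ))) * uu (X + 1) := by
    unfold ww
    apply mul_le_mul_of_nonneg_left (uu_mono_succ X) (by positivity)
  rw [wt_cons] at hw
  obtain ⟨Y, rfl⟩ : ∃ Y, X = Y + 1 := ⟨X - 1, by omega⟩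
  by_cases hd2 : d = 2
  · subst hd2
    simp only [show 2 - 1 = 1 from rfl, Finset.sum_range_one]
    obtain ⟨hY, h⟩ := Ztwo hc hP Y r hr (by simp only [wt_cons]; omega) (by omega)
    refine h.trans ?_
    have h2 := ww_mono hY (Nat.le_succ Y)
    have e : (1 + 1 / (3 * ((Y : ℝ) + 1))) * ww Y ≤ (1 + 1 / (3 * ((Y : ℝ) + 1))) *
        ((1 + 2 / (3 * ((Y + 1 : ℕ) : ℝ))) * uu (Y + 1 + 1)) :=
      mul_le_mul_of_nonneg_left (h2.trans hwX) (by positivity)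
    refine e.trans ?_
    rw [← mul_assoc]
    have e3 : (((2 : ℕ) : ℝ) - 1) * uu (Y + 1 + 1) + 4 / (3 * ((Y + 1 : ℕ) : ℝ)) * uu (Y + 1 + 1)
        = (1 + 4 / (3 * ((Y + 1 : ℕ) : ℝ))) * uu (Y + 1 + 1) := by push_cast; ring
    rw [e3]
    apply mul_le_mul_of_nonneg_right _ hU.le
    push_cast
    set t : ℝ := 1 / ((Y : ℝ) + 1) with ht
    have ht0 : 0 ≤ t := by positivity
    have ht1 : t ≤ 1 := by
      rw [ht, div_le_one (by positivity)]; linarith [Nat.cast_nonneg (α := ℝ) Y]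
    have a1 : 1 / (3 * ((Y : ℝ) + 1)) = t / 3 := by rw [ht]; field_simp
    have a2 : 2 / (3 * ((Y : ℝ) + 1)) = 2 * t / 3 := by rw [ht]; field_simp
    have a3 : 4 / (3 * ((Y : ℝ) + 1)) = 4 * t / 3 := by rw [ht]; field_simp
    rw [a1, a2, a3]
    nlinarith
  · have hterm : ∀ a ∈ Finset.range (d - 1), c (a :: (d - 2 - a) :: r) ≤
        uu (Y + 1 + 1) + ((if a = 0 then 2 / (3 * ((Y + 1 : ℕ) : ℝ)) * uu (Y + 1 + 1) else 0)
          + (if a = d - 2 then 2 / (3 * ((Y + 1 : ℕ) : ℝ)) * uu (Y + 1 + 1) else 0)) := by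
      intro a ha
      rw [Finset.mem_range] at ha
      by_cases h0 : a = 0
      · subst h0
        rw [if_pos rfl, if_neg (by omega)]
        have := Zone hc hP Y ((d - 2) :: r) (by
          intro x hx
          rcases List.mem_cons.1 hx with rfl | hx
          · omega
          · exact hr1 x hx) (by simp only [wt_cons]; omega) (by omega)
        simp only [Nat.sub_zero]
        linarith
      by_cases h1 : a = d - 2
      · subst h1
        rw [if_neg h0, if_pos rfl, Nat.sub_self]
        have := Zone hc hP Y ((d - 2) :: r) (by
          intro x hx
          rcases List.mem_cons.1 hx with rfl | hx
          · omega
          · exact hr1 x hx) (by simp only [wt_cons]; omega) (by omega)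
        rw [hc.symm (List.Perm.swap 0 (d - 2) r)]
        linarith
      · rw [if_neg h0, if_neg h1]
        have := hP (a :: (d - 2 - a) :: r) (Y + 1 + 1) (by simp) (by
          intro x hx
          rcases List.mem_cons.1 hx with rfl | hx
          · omega
          rcases List.mem_cons.1 hx with rfl | hx
          · omega
          · exact hr1 x hx) (by simp only [wt_cons]; omega) (by omega)
        linarith
    refine (Finset.sum_le_sum hterm).trans ?_
    rw [Finset.sum_add_distrib, Finset.sum_add_distrib, Finset.sum_ite_eq', Finset.sum_ite_eq',
      if_pos (by simp; omega), if_pos (by simp; omega)]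
    simp only [Finset.sum_const, Finset.card_range, nsmul_eq_mul]
    rw [Nat.cast_sub (by omega)]
    apply le_of_eq
    push_cast
    ring

lemma RW.dvv' (hc : RW c) {d : ℕ} {r : List ℕ} {X : ℕ} (hw : wt (d :: r) = 3 * (X + 2)) (hd : 1 ≤ d) :
    c (d :: r) = 1 / (3 * ((X : ℝ) + 1)) *
        (((picks r).map (fun p => (2 * (p.1 : ℝ) + 1) * c ((d + p.1 - 1) :: p.2))).sum
          + 2 * ∑ a ∈ Finset.range (d - 1), c (a :: (d - 2 - a) :: r)) + prodT c d r X := by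
  rw [hc.dvv d r X hw]
  unfold prodT
  congr 4
  apply List.map_congr_left
  intro p hp
  rw [if_pos (by omega)]

lemma PB_step (hc : RW c) {X d : ℕ} {r : List ℕ} (hP : PB c (X + 1)) (hX : 1 ≤ X)
    (hd : 2 ≤ d) (hr : ∀ x ∈ r, 2 ≤ x) (hw : wt (d :: r) = 3 * (X + 2)) {G : ℕ}
    (hg : Gen (d :: r) (G + 2)) : c (d :: r) ≤ uu (X + 2) := by
  have hXr : (1 : ℝ) ≤ X := by exact_mod_cast hX
  have hU := uu_pos (X + 1)
  have hr1 : ∀ x ∈ r, 1 ≤ x := fun x hx => by have := hr x hx; omega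
  rw [hc.dvv' hw (by omega)]
  have b1 : ((picks r).map (fun p => (2 * (p.1 : ℝ) + 1) * c ((d + p.1 - 1) :: p.2))).sum
      ≤ wt r * uu (X + 1) := by
    rw [← sum_picks_wt, ← List.sum_map_mul_right]
    apply list_sum_le
    intro p hp
    apply mul_le_mul_of_nonneg_left _ (by positivity)
    have hm := picks_mem hp
    have hpw := picks_wt hp
    refine hP _ (X + 1) (by simp) ?_ (by simp only [wt_cons] at *; omega) le_rfl
    intro x hx
    rcases List.mem_cons.1 hx with rfl | hx
    · omega
    · exact hr1 x (hm.2 x hx)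
  have b2 := split_sum_le hc hP hX hd hr hw
  have b3 : prodT c d r X ≤ (ww X) ^ 2 / (((X : ℝ) + 1) * X) := by
    apply prodT_le hc ((uu_pos X).le.trans (uu_le_ww X)) hg hw hr
    intro a p hp hpw
    by_cases hgg : ∃ g, Gen (a :: p) g
    swap
    · rw [hc.vanish _ hgg]; exact (uu_pos X).le.trans (uu_le_ww X)
    obtain ⟨g, hgg⟩ := hgg
    obtain ⟨t, ht⟩ := exists_level (by simp) hgg
    have htX : t + 1 ≤ X := by omega
    have hp1 : ∀ x ∈ p, 1 ≤ x := fun x hx => by have := hp x hx; omega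
    by_cases ha : a = 0
    · subst ha
      rcases t with _ | t
      · exfalso
        rw [wt_cons] at ht
        rcases p with _ | ⟨b, q⟩
        · simp at ht
        · have := hp b (by simp)
          simp at ht; omega
      · have := Zone hc hP t p hp1 ht (by omega)
        exact this.trans (ww_mono (by omega) (by omega))
    · have := hP (a :: p) (t + 1) (by simp) (by
        intro x hx
        rcases List.mem_cons.1 hx with rfl | hx
        · omega
        · exact hp1 x hx) ht (by omega)
      exact this.trans ((uu_mono htX).trans (uu_le_ww X))
  have hwr : (wt r : ℝ) = 3 * X + 5 - 2 * d := by
    rw [wt_cons] at hw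
    have : (wt r : ℝ) + 2 * d = 3 * X + 5 := by exact_mod_cast (by omega : wt r + 2 * d = 3 * X + 5)
    linarith
  rw [hwr] at b1
  have lin : 1 / (3 * ((X : ℝ) + 1)) *
        (((picks r).map (fun p => (2 * (p.1 : ℝ) + 1) * c ((d + p.1 - 1) :: p.2))).sum
          + 2 * ∑ a ∈ Finset.range (d - 1), c (a :: (d - 2 - a) :: r))
      ≤ uu (X + 1) * (1 + 8 / 9 / (((X : ℝ) + 1) * X)) := by
    have : uu (X + 1) * (1 + 8 / 9 / (((X : ℝ) + 1) * X)) = 1 / (3 * ((X : ℝ) + 1)) *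
      ((3 * X + 5 - 2 * d) * uu (X + 1) +
        2 * (((d : ℝ) - 1) * uu (X + 1) + 4 / (3 * (X : ℝ)) * uu (X + 1))) := by
      field_simp; ring
    rw [this]
    apply mul_le_mul_of_nonneg_left _ (by positivity)
    linarith
  have := ww_sq X hX
  linarith

lemma PB_all (hc : RW c) : ∀ L, PB c L := by
  intro L
  induction L with
  | zero =>
    intro l X hl hpos hw hX
    exfalso
    rcases l with _ | ⟨a, t⟩
    · exact hl rfl
    · rw [wt_cons] at hw; omega
  | succ L ih =>
    intro l X hl hpos hw hX
    by_cases hX2 : X ≤ L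
    · exact ih l X hl hpos hw hX2
    have hXL : X = L + 1 := by omega
    subst hXL
    by_cases h1 : 1 ∈ l
    · have hp := perm_of_mem h1
      have hw1 := wt_perm hp
      rw [hc.symm hp]
      rw [wt_cons] at hw1
      by_cases he : l.erase 1 = []
      · rw [he, hc.init1, ← uu_one]
        exact uu_mono (by omega)
      · have hw2 : wt (l.erase 1) = 3 * L := by omega
        rcases L with _ | L
        · exfalso
          rcases h : l.erase 1 with _ | ⟨a, t⟩
          · exact he h
          · rw [h, wt_cons] at hw2; omega
        rw [hc.dilaton hw2]
        exact (ih _ (L + 1) he (fun x hx => hpos x (List.mem_of_mem_erase hx)) hw2 le_rfl).trans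
          (uu_mono_succ _)
    · have h2 := two_le_of_not_mem hpos h1
      by_cases hgg : ∃ g, Gen l g
      swap
      · rw [hc.vanish _ hgg]; exact (uu_pos _).le
      obtain ⟨g, hg⟩ := hgg
      have ht := two_mul_len_le h2
      have hn : 1 ≤ l.length := List.length_pos_iff.2 hl
      have hg' := hg
      have hgw := hg.wt_eq
      unfold Gen at hg'
      obtain ⟨G, rfl⟩ : ∃ G, g = G + 2 := ⟨g - 2, by omega⟩
      obtain ⟨Y, rfl⟩ : ∃ Y, L = Y + 1 := ⟨L - 1, by omega⟩
      rcases l with _ | ⟨d, r⟩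
      · exact absurd rfl hl
      exact PB_step hc ih (by omega) (h2 d (by simp)) (fun x hx => h2 x (by simp [hx])) hw hg

lemma RW.pos_le_one (hc : RW c) {l : List ℕ} (hl : l ≠ []) (hpos : ∀ x ∈ l, 1 ≤ x) : c l ≤ 1 := by
  by_cases hgg : ∃ g, Gen l g
  swap
  · rw [hc.vanish _ hgg]; norm_num
  obtain ⟨g, hg⟩ := hgg
  obtain ⟨X, hX⟩ := exists_level hl hg
  exact (PB_all hc (X + 1) l (X + 1) hl hpos hX le_rfl).trans (uu_le_one _)

lemma bound_aux (hc : RW c) : ∀ N : ℕ, ∀ l : List ℕ, wt l ≤ N → l ≠ [] →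
    (nz l ≤ 1 → c l ≤ 1) ∧ c l ≤ 4 / 3 := by
  intro N
  induction N using Nat.strong_induction_on with
  | _ N ih =>
  intro l hN hl
  by_cases hgg : ∃ g, Gen l g
  swap
  · rw [hc.vanish _ hgg]; norm_num
  obtain ⟨g, hg⟩ := hgg
  obtain ⟨X, hX⟩ := exists_level hl hg
  by_cases hz0 : nz l = 0
  · have := hc.pos_le_one hl (nz_eq_zero.1 hz0)
    exact ⟨fun _ => this, by linarith⟩
  have h0 : 0 ∈ l := by
    by_contra h
    exact hz0 (List.count_eq_zero.2 h)
  have hp := perm_of_mem h0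
  set s := l.erase 0
  have hcs := hc.symm hp
  have hws := wt_perm hp
  have hzs := nz_perm hp
  rw [nz_cons_zero] at hzs
  by_cases hz1 : nz l = 1
  · have hs : ∀ x ∈ s, 1 ≤ x := nz_eq_zero.1 (by omega)
    have : c l ≤ 1 := by
      rcases X with _ | X
      · rcases level_one hX with rfl | rfl
        · rw [hc.init1]; norm_num
        · rw [hc.init3]; norm_num
      · rw [hcs]
        have := Zone hc (PB_all hc (X + 1)) X s hs (by rw [← hws]; exact hX) le_rfl
        exact this.trans (ww_le_one _ (by omega))
    exact ⟨fun _ => this, by linarith⟩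
  refine ⟨fun h => by omega, ?_⟩
  rcases X with _ | X
  · rcases level_one hX with rfl | rfl
    · rw [hc.init1]; norm_num
    · rw [hc.init3]; norm_num
  have hXr : (0 : ℝ) ≤ X := Nat.cast_nonneg X
  by_cases h1 : 1 ∈ l
  · have hp := perm_of_mem h1
    have hw1 := wt_perm hp
    rw [wt_cons] at hw1
    rw [hc.symm hp, hc.dilaton (X := X) (by omega)]
    refine (ih (N - 1) (by omega) _ (by omega) ?_).2
    intro he
    rw [he] at hw1
    simp at hw1
    omega
  · have hw : wt (0 :: s) = 3 * (X + 2) := by rw [← hws]; exact hX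
    have hpk : ∀ p ∈ picks s, 1 ≤ p.1 → wt ((p.1 - 1) :: p.2) ≤ N - 1 ∧ nz ((p.1 - 1) :: p.2) = nz s := by
      intro p hp' hp1
      have hm := picks_mem hp'
      have hpw := picks_wt hp'
      have h2 : p.1 ≠ 1 := by
        intro h
        apply h1
        rw [h] at hm
        exact hp.mem_iff.2 (List.mem_cons_of_mem _ hm.1)
      rw [wt_cons, nz_cons_pos (by omega)]
      rw [wt_cons] at hw
      refine ⟨by omega, ?_⟩
      rw [nz_perm (picks_perm s p hp'), nz_cons_pos hp1]
    rw [wt_cons] at hws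
    rw [hcs]
    by_cases hz2 : nz s = 1
    · have h := hc.string_le (B := 1) hw (fun p hp' hp1 =>
        (ih (N - 1) (by omega) _ (hpk p hp' hp1).1 (by simp)).1 (by rw [(hpk p hp' hp1).2, hz2]))
      refine h.trans ?_
      rw [hz2]
      have : (2 - ((1 : ℕ) : ℝ)) / (3 * ((X : ℝ) + 1)) ≤ 1 / 3 := by
        rw [div_le_div_iff₀ (by positivity) (by norm_num)]; push_cast; linarith
      linarith
    · have h := hc.string_le (B := 4 / 3) hw (fun p hp' hp1 =>
        (ih (N - 1) (by omega) _ (hpk p hp' hp1).1 (by simp)).2)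
      refine h.trans ?_
      have h2 : (2 : ℝ) ≤ nz s := by exact_mod_cast (by omega : 2 ≤ nz s)
      have : (2 - (nz s : ℝ)) / (3 * ((X : ℝ) + 1)) ≤ 0 := by
        apply div_nonpos_of_nonpos_of_nonneg <;> [linarith; positivity]
      linarith

lemma RW.le_bound (hc : RW c) {l : List ℕ} (hl : l ≠ []) : c l ≤ 4 / 3 :=
  (bound_aux hc _ l le_rfl hl).2

lemma prodT_le_four (hc : RW c) {d : ℕ} {r : List ℕ} {X G : ℕ}
    (hg : Gen (d :: r) (G + 2)) (hw : wt (d :: r) = 3 * (X + 2))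
    (hr : ∀ x ∈ r, 2 ≤ x) :
    prodT c d r X ≤ (4 / 3) ^ 2 / (((X : ℝ) + 1) * X) :=
  prodT_le hc (by norm_num) hg hw hr (fun _ _ _ _ => hc.le_bound (by simp))




lemma nz_le_wt (l : List ℕ) : nz l ≤ wt l := (nz_le_length l).trans (by unfold wt; omega)

lemma RW.string_abs (hc : RW c) {r : List ℕ} {X : ℕ} (h : wt (0 :: r) = 3 * (X + 2)) {B γ : ℝ}
    (hB : ∀ p ∈ picks r, 1 ≤ p.1 → |c ((p.1 - 1) :: p.2) - γ| ≤ B) :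
    |c (0 :: r) - (1 + (2 - (nz r : ℝ)) / (3 * ((X : ℝ) + 1))) * γ|
      ≤ (1 + (2 - (nz r : ℝ)) / (3 * ((X : ℝ) + 1))) * B := by
  rw [hc.string h, ← string_weight h, mul_assoc, mul_assoc, ← mul_sub, abs_mul,
    abs_of_nonneg (by positivity : (0 : ℝ) ≤ 1 / (3 * ((X : ℝ) + 1)))]
  apply mul_le_mul_of_nonneg_left _ (by positivity)
  rw [← sum_picks_pos, ← List.sum_map_mul_right, ← List.sum_map_mul_right]
  have e : ∀ (L : List (ℕ × List ℕ)) (f k : ℕ × List ℕ → ℝ), (L.map f).sum - (L.map k).sum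
      = (L.map (fun p => f p - k p)).sum := by
    intro L f k
    induction L with
    | nil => simp
    | cons x L ih => simp only [List.map_cons, List.sum_cons, ← ih]; ring
  rw [e]
  refine (list_abs_sum_le _ _).trans ?_
  apply list_sum_le
  intro p hp
  rw [mul_assoc, ← mul_sub, abs_mul, abs_of_nonneg (by positivity : (0 : ℝ) ≤ 2 * (p.1 : ℝ) + 1),
    mul_assoc]
  apply mul_le_mul_of_nonneg_left _ (by positivity)
  split_ifs with h1
  · simpa using hB p hp h1
  · simp

lemma Zasym (hc : RW c) {g n : ℕ} (hg : 2 ≤ g) {γ B : ℝ} (h0 : 0 ≤ γ) (h1 : γ ≤ 4 / 3) (hB0 : 0 ≤ B)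
    (hB : ∀ l : List ℕ, l ≠ [] → (∀ x ∈ l, 1 ≤ x) → Gen l g → l.length ≤ n → |c l - γ| ≤ B) :
    ∀ N : ℕ, ∀ l : List ℕ, l ≠ [] → Gen l g → l.length ≤ N → l.length ≤ n + nz l →
      |c l - γ| ≤ B + 2 * (nz l : ℝ) ^ 2 / g := by
  intro N
  induction N with
  | zero =>
    intro l hl _ hN
    exact absurd (List.length_eq_zero_iff.1 (by omega)) hl
  | succ N ih =>
    intro l hl hgl hN hn
    by_cases hz0 : nz l = 0
    · have := hB l hl (nz_eq_zero.1 hz0) hgl (by omega)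
      rw [hz0]; simpa using this
    have h0l : 0 ∈ l := by
      by_contra h
      exact hz0 (List.count_eq_zero.2 h)
    have hgw := hgl.wt_eq
    have hln : 1 ≤ l.length := List.length_pos_iff.2 hl
    by_cases h1l : 1 ∈ l
    · have hp := perm_of_mem h1l
      have hw1 := wt_perm hp
      have hl1 := hp.length_eq
      have hz1 := nz_perm hp
      have hg1 := gen_of_perm hp hgl
      rw [nz_cons_pos le_rfl] at hz1
      rw [wt_cons] at hw1
      rw [List.length_cons] at hl1
      have hne : l.erase 1 ≠ [] := by
        intro he
        rw [he] at hz1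
        simp [nz] at hz1
        exact hz0 hz1
      rw [hc.symm hp, hc.dilaton (X := 2 * g + l.length - 4) (by omega), hz1]
      refine ih _ hne ?_ (by omega) (by omega)
      unfold Gen at hg1 ⊢
      simp only [List.sum_cons, List.length_cons] at hg1
      omega
    · have hp := perm_of_mem h0l
      set s := l.erase 0
      have hw1 := wt_perm hp
      have hl1 := hp.length_eq
      have hz1 := nz_perm hp
      have hg1 := gen_of_perm hp hgl
      rw [nz_cons_zero] at hz1
      rw [List.length_cons] at hl1
      obtain ⟨X, hX⟩ : ∃ X, X + 4 = 2 * g + l.length := ⟨2 * g + l.length - 4, by omega⟩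
      have hw : wt (0 :: s) = 3 * (X + 2) := by omega
      have hgr : (2 : ℝ) ≤ g := by exact_mod_cast hg
      have hXg : (g : ℝ) ≤ X + 1 := by exact_mod_cast (by omega : g ≤ X + 1)
      set z : ℝ := (nz s : ℝ) with hz
      have hz0' : 0 ≤ z := Nat.cast_nonneg _
      have key : ∀ p ∈ picks s, 1 ≤ p.1 →
          |c ((p.1 - 1) :: p.2) - γ| ≤ min (B + 2 * z ^ 2 / g) (4 / 3) := by
        intro p hp' hp1
        have hm := picks_mem hp'
        have hpp := picks_perm s p hp'
        have h2 : p.1 ≠ 1 := by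
          intro h
          apply h1l
          rw [h] at hm
          exact hp.mem_iff.2 (List.mem_cons_of_mem _ hm.1)
        have hlen := hpp.length_eq
        have hsum := hpp.sum_eq
        have hzz := nz_perm hpp
        rw [nz_cons_pos hp1] at hzz
        simp only [List.sum_cons, List.length_cons] at hlen hsum
        have hz2 : nz ((p.1 - 1) :: p.2) = nz s := by rw [nz_cons_pos (by omega), hzz]
        apply le_min
        · rw [hz, ← hz2]
          refine ih _ (by simp) ?_ (by simp; omega) (by rw [hz2]; simp; omega)
          unfold Gen at hg1 ⊢
          simp only [List.sum_cons, List.length_cons] at hg1 ⊢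
          omega
        · have b1 := hc.nonneg (l := (p.1 - 1) :: p.2) (by simp)
          have b2 := hc.le_bound (l := (p.1 - 1) :: p.2) (by simp)
          rw [abs_le]; constructor <;> linarith
      have h := hc.string_abs hw key
      rw [hc.symm hp, hz1]
      set δ : ℝ := (2 - z) / (3 * ((X : ℝ) + 1)) with hδ
      have hδa : |δ| ≤ 2 * (z + 1) / (3 * g) := by
        rw [hδ, abs_div, abs_of_pos (by positivity : (0 : ℝ) < 3 * ((X : ℝ) + 1))]
        apply div_le_div₀ (by positivity) _ (by positivity) (by linarith)
        rw [abs_le]; constructor <;> linarith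
      set m := min (B + 2 * z ^ 2 / g) (4 / 3)
      have m1 : m ≤ B + 2 * z ^ 2 / g := min_le_left _ _
      have m2 : m ≤ 4 / 3 := min_le_right _ _
      have m0 : 0 ≤ m := le_min (by positivity) (by norm_num)
      have a1 : |c (0 :: s) - γ| ≤ |c (0 :: s) - (1 + δ) * γ| + |δ| * γ := by
        have : c (0 :: s) - γ = (c (0 :: s) - (1 + δ) * γ) + δ * γ := by ring
        rw [this]
        refine (abs_add_le _ _).trans ?_
        rw [abs_mul δ γ, abs_of_nonneg h0]
      have a2 : (1 + δ) * m ≤ m + |δ| * m := by nlinarith [le_abs_self δ]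
      have a3 : |δ| * m + |δ| * γ ≤ |δ| * (8 / 3) := by nlinarith [abs_nonneg δ]
      have a4 : |δ| * (8 / 3) ≤ 2 * (z + 1) / g := by
        have : 2 * (z + 1) / (3 * g) * (8 / 3) ≤ 2 * (z + 1) / g := by
          rw [div_mul_eq_mul_div, div_le_div_iff₀ (by positivity) (by positivity)]
          nlinarith [mul_nonneg hz0' (by linarith : (0 : ℝ) ≤ g)]
        nlinarith
      have a5 : 2 * z ^ 2 / g + 2 * (z + 1) / g ≤ 2 * ((nz s + 1 : ℕ) : ℝ) ^ 2 / g := by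
        rw [← add_div]
        apply div_le_div_of_nonneg_right _ (by positivity)
        push_cast
        rw [← hz]
        nlinarith
      linarith

lemma split_abs (hc : RW c) {d : ℕ} {r : List ℕ} {g : ℕ} (hd : 2 ≤ d) (hr : ∀ x ∈ r, 1 ≤ x)
    (hg : Gen (d :: r) (g + 1)) (hg2 : 2 ≤ g) {B γ' : ℝ} (h0 : 0 ≤ γ') (h1 : γ' ≤ 4 / 3) (hB0 : 0 ≤ B)
    (h2 : ∀ l : List ℕ, l ≠ [] → (∀ x ∈ l, 1 ≤ x) → Gen l g → l.length ≤ r.length + 2 → |c l - γ'| ≤ B) :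
    ∑ a ∈ Finset.range (d - 1), |c (a :: (d - 2 - a) :: r) - γ'| ≤ (d - 1) * B + 8 / g := by
  have hterm : ∀ a ∈ Finset.range (d - 1), |c (a :: (d - 2 - a) :: r) - γ'| ≤
      B + ((if a = 0 then 4 / (g : ℝ) else 0) + (if a = d - 2 then 4 / (g : ℝ) else 0)) := by
    intro a ha
    rw [Finset.mem_range] at ha
    have hgen : Gen (a :: (d - 2 - a) :: r) g := by
      unfold Gen at hg ⊢
      simp only [List.sum_cons, List.length_cons] at hg ⊢
      omega
    have h := Zasym hc hg2 h0 h1 hB0 h2 (r.length + 2) (a :: (d - 2 - a) :: r) (by simp) hgen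
      (by simp) (by simp)
    refine h.trans ?_
    have hzr := nz_eq_zero.2 hr
    have hgr : (2 : ℝ) ≤ g := by exact_mod_cast hg2
    apply add_le_add_right
    rw [div_eq_mul_inv, div_eq_mul_inv]
    have hi : 0 < (g : ℝ)⁻¹ := by positivity
    by_cases ha0 : a = 0
    · subst ha0
      rw [if_pos rfl, nz_cons_zero]
      by_cases hd2 : d = 2
      · subst hd2
        simp [hzr]; linarith
      · rw [nz_cons_pos (by omega), hzr, if_neg (by omega)]
        norm_num; linarith
    · rw [if_neg ha0, nz_cons_pos (by omega)]
      by_cases ha1 : a = d - 2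
      · subst ha1
        simp [hzr]; linarith
      · rw [if_neg ha1, nz_cons_pos (by omega), hzr]; simp
  refine (Finset.sum_le_sum hterm).trans ?_
  rw [Finset.sum_add_distrib, Finset.sum_add_distrib, Finset.sum_ite_eq', Finset.sum_ite_eq',
      if_pos (by simp; omega), if_pos (by simp; omega)]
  simp only [Finset.sum_const, Finset.card_range, nsmul_eq_mul]
  rw [Nat.cast_sub (by omega)]
  apply le_of_eq
  push_cast
  ring

lemma picks_abs {d : ℕ} {r : List ℕ} {g : ℕ} (hd : 1 ≤ d) (hr : ∀ x ∈ r, 1 ≤ x)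
    (hg : Gen (d :: r) g) {B γ : ℝ}
    (h1 : ∀ l : List ℕ, l ≠ [] → (∀ x ∈ l, 1 ≤ x) → Gen l g → l.length = r.length → |c l - γ| ≤ B) :
    |((picks r).map (fun p => (2 * (p.1 : ℝ) + 1) * (c ((d + p.1 - 1) :: p.2) - γ))).sum| ≤ wt r * B := by
  refine (list_abs_sum_le _ _).trans ?_
  rw [← sum_picks_wt, ← List.sum_map_mul_right]
  apply list_sum_le
  intro p hp
  rw [abs_mul, abs_of_nonneg (by positivity : (0 : ℝ) ≤ 2 * (p.1 : ℝ) + 1)]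
  apply mul_le_mul_of_nonneg_left _ (by positivity)
  have hm := picks_mem hp
  have hpp := picks_perm r p hp
  have hlen := hpp.length_eq
  have hsum := hpp.sum_eq
  have := hr _ hm.1
  simp only [List.sum_cons, List.length_cons] at hlen hsum
  refine h1 _ (by simp) ?_ ?_ (by simp; omega)
  · intro x hx
    rcases List.mem_cons.1 hx with rfl | hx
    · omega
    · exact hr x (hm.2 x hx)
  · unfold Gen at hg ⊢
    simp only [List.sum_cons, List.length_cons] at hg ⊢
    omega

lemma one_step (hc : RW c) {d : ℕ} {r : List ℕ} {g X : ℕ} (hd : 2 ≤ d) (hr : ∀ x ∈ r, 2 ≤ x)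
    (hg : Gen (d :: r) (g + 1)) (hg2 : 2 ≤ g) (hw : wt (d :: r) = 3 * (X + 2))
    {B1 B2 γ γ' q : ℝ} (h0' : 0 ≤ γ') (h1' : γ' ≤ 4 / 3) (hB0 : 0 ≤ B2)
    (hq : q = 2 * ((d : ℝ) - 1) / (3 * ((X : ℝ) + 1)))
    (h1 : ∀ l : List ℕ, l ≠ [] → (∀ x ∈ l, 1 ≤ x) → Gen l (g + 1) → l.length = r.length → |c l - γ| ≤ B1)
    (h2 : ∀ l : List ℕ, l ≠ [] → (∀ x ∈ l, 1 ≤ x) → Gen l g → l.length ≤ r.length + 2 → |c l - γ'| ≤ B2) :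
    |c (d :: r) - γ| ≤ (1 - q) * B1 + q * (B2 + |γ - γ'|) + 10 / ((g : ℝ) + 1) ^ 2 := by
  have hr1 : ∀ x ∈ r, 1 ≤ x := fun x hx => by have := hr x hx; omega
  have s1 := picks_abs (by omega) hr1 hg h1
  have s2 := split_abs hc hd hr1 hg hg2 h0' h1' hB0 h2
  have hgw := hg.wt_eq
  rw [hw] at hgw
  simp only [List.length_cons] at hgw
  obtain ⟨G, rfl⟩ : ∃ G, g = G + 1 := ⟨g - 1, by omega⟩
  have s3 := prodT_le_four hc (G := G) hg hw hr
  have s4 := prodT_nonneg hc d r X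
  have hgr : (2 : ℝ) ≤ ((G + 1 : ℕ) : ℝ) := by exact_mod_cast hg2
  set t : ℝ := ((G + 1 : ℕ) : ℝ) with ht
  have hXg : 2 * t - 1 ≤ X := by
    have : 2 * t ≤ X + 1 := by rw [ht]; exact_mod_cast (by omega : 2 * (G + 1) ≤ X + 1)
    linarith
  have hwr : (wt r : ℝ) = 3 * X + 5 - 2 * d := by
    rw [wt_cons] at hw
    have : (wt r : ℝ) + 2 * d = 3 * X + 5 := by exact_mod_cast (by omega : wt r + 2 * d = 3 * X + 5)
    linarith
  have hX1 : (0 : ℝ) < X + 1 := by linarith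
  have eq1 : c (d :: r) - γ = 1 / (3 * ((X : ℝ) + 1)) *
      (((picks r).map (fun p => (2 * (p.1 : ℝ) + 1) * (c ((d + p.1 - 1) :: p.2) - γ))).sum
       + 2 * (∑ a ∈ Finset.range (d - 1), (c (a :: (d - 2 - a) :: r) - γ') + (d - 1) * (γ' - γ)))
      + prodT c d r X := by
    rw [hc.dvv' hw (by omega)]
    have e1 : ((picks r).map (fun p => (2 * (p.1 : ℝ) + 1) * (c ((d + p.1 - 1) :: p.2) - γ))).sum
        = ((picks r).map (fun p => (2 * (p.1 : ℝ) + 1) * c ((d + p.1 - 1) :: p.2))).sum - wt r * γ := by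
      rw [← sum_picks_wt, ← List.sum_map_mul_right]
      generalize picks r = L
      induction L with
      | nil => simp
      | cons x L ih => simp only [List.map_cons, List.sum_cons, ih]; ring
    rw [e1, Finset.sum_sub_distrib, hwr]
    simp only [Finset.sum_const, Finset.card_range, nsmul_eq_mul]
    rw [Nat.cast_sub (by omega)]
    push_cast
    field_simp
    ring
  rw [eq1]
  have s2' : |∑ a ∈ Finset.range (d - 1), (c (a :: (d - 2 - a) :: r) - γ')| ≤ (d - 1) * B2 + 8 / t :=
    (Finset.abs_sum_le_sum_abs _ _).trans s2
  have hd1 : (0 : ℝ) ≤ d - 1 := by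
    have : (2 : ℝ) ≤ d := by exact_mod_cast hd
    linarith
  have hJ : |(d - 1) * (γ' - γ)| = (d - 1) * |γ - γ'| := by
    rw [abs_mul, abs_of_nonneg hd1, abs_sub_comm]
  set P := ((picks r).map (fun p => (2 * (p.1 : ℝ) + 1) * (c ((d + p.1 - 1) :: p.2) - γ))).sum
  set S := ∑ a ∈ Finset.range (d - 1), (c (a :: (d - 2 - a) :: r) - γ')
  have b1 : |P + 2 * (S + (d - 1) * (γ' - γ))| ≤
      wt r * B1 + 2 * ((d - 1) * B2 + 8 / t + (d - 1) * |γ - γ'|) := by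
    refine (abs_add_le _ _).trans ?_
    rw [abs_mul, abs_of_pos (by norm_num : (0 : ℝ) < 2)]
    have := abs_add_le S ((d - 1) * (γ' - γ))
    rw [hJ] at this
    linarith
  refine (abs_add_le _ _).trans ?_
  rw [abs_mul, abs_of_pos (by positivity : (0 : ℝ) < 1 / (3 * ((X : ℝ) + 1))), abs_of_nonneg s4]
  have b2 := mul_le_mul_of_nonneg_left b1 (by positivity : (0 : ℝ) ≤ 1 / (3 * ((X : ℝ) + 1)))
  have e3 : 1 / (3 * ((X : ℝ) + 1)) * (wt r * B1 + 2 * ((d - 1) * B2 + 8 / t + (d - 1) * |γ - γ'|))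
      = (1 - q) * B1 + q * (B2 + |γ - γ'|) + 16 / (3 * (((X : ℝ) + 1) * t)) := by
    rw [hwr, hq]; field_simp; ring
  rw [e3] at b2
  have b3 : 16 / (3 * (((X : ℝ) + 1) * t)) ≤ 6 / (t + 1) ^ 2 := by
    rw [div_le_div_iff₀ (by positivity) (by positivity)]
    nlinarith
  have b4 : (4 / 3) ^ 2 / (((X : ℝ) + 1) * X) ≤ 2 / (t + 1) ^ 2 := by
    rw [div_le_div_iff₀ (by apply mul_pos hX1; linarith) (by positivity)]
    nlinarith
  have b5 : 6 / (t + 1) ^ 2 + 2 / (t + 1) ^ 2 ≤ 10 / (t + 1) ^ 2 := by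
    rw [← add_div]; apply div_le_div_of_nonneg_right _ (by positivity); norm_num
  linarith

lemma sum_min (N : ℕ) : 4 * ∑ a ∈ Finset.range (N + 1), min a (N - a) ≤ N ^ 2 := by
  induction N using Nat.twoStepInduction with
  | zero => simp
  | one => simp [Finset.sum_range_succ]
  | more N ih _ =>
    have e : ∑ a ∈ Finset.range (N + 2 + 1), min a (N + 2 - a)
        = ∑ a ∈ Finset.range (N + 1), min a (N - a) + (N + 1) := by
      rw [Finset.sum_range_succ, Finset.sum_range_succ']
      have : ∀ a ∈ Finset.range (N + 1), min (a + 1) (N + 2 - (a + 1)) = min a (N - a) + 1 := by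
        intro a ha
        rw [Finset.mem_range] at ha
        omega
      rw [Finset.sum_congr rfl this, Finset.sum_add_distrib]
      simp
    rw [e]
    nlinarith




/-- The weight attached to the length of a list in the induction on the genus. -/
def phi (n : ℕ) : ℝ := if n ≤ 1 then 0 else if n = 2 then 7 else 2 * n + 4

/-- The error scale in genus `g`. -/
def hh (g : ℕ) : ℝ := 1000000 / (g : ℝ) ^ 2

/-- The one-point value in genus `g`. -/
def gam (c : List ℕ → ℝ) (g : ℕ) : ℝ := c [3 * g - 2]

def HH (c : List ℕ → ℝ) (g : ℕ) : Prop :=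
  ∀ l : List ℕ, l ≠ [] → (∀ x ∈ l, 1 ≤ x) → Gen l g → |c l - gam c g| ≤ phi l.length * hh g

def JJ (c : List ℕ → ℝ) (g : ℕ) : Prop := |gam c (g + 1) - gam c g| ≤ 3.4 * hh (g + 1)

lemma hh_nonneg (g : ℕ) : 0 ≤ hh g := by unfold hh; positivity

lemma phi_mono_succ (n : ℕ) : phi n ≤ phi (n + 1) := by
  rcases n with _ | _ | _ | n
  · simp [phi]
  · simp [phi]
  · norm_num [phi]
  · have h1 : phi (n + 1 + 1 + 1) = 2 * ((n : ℝ) + 3) + 4 := by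
      unfold phi; rw [if_neg (by omega), if_neg (by omega)]; push_cast; ring
    have h2 : phi (n + 1 + 1 + 1 + 1) = 2 * ((n : ℝ) + 4) + 4 := by
      unfold phi; rw [if_neg (by omega), if_neg (by omega)]; push_cast; ring
    linarith

lemma phi_mono {m n : ℕ} (h : m ≤ n) : phi m ≤ phi n := monotone_nat_of_le_succ phi_mono_succ h

lemma phi_nonneg (n : ℕ) : 0 ≤ phi n := by
  have := phi_mono (Nat.zero_le n)
  simpa [phi] using this

lemma phi_big (n : ℕ) : phi (n + 3) = 2 * n + 10 := by
  unfold phi; rw [if_neg (by omega), if_neg (by omega)]; push_cast; ring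

lemma phi_step (n : ℕ) : phi (n + 1) + (1.0021 * phi (n + 3) + 3.4 - phi (n + 1)) / ((n : ℝ) + 2) + 0.00001
    ≤ phi (n + 2) := by
  rcases n with _ | _ | _ | n
  · norm_num [phi]
  · norm_num [phi]
  · norm_num [phi]
  · have h1 := phi_big (n + 1)
    have h2 := phi_big (n + 2)
    have h3 := phi_big (n + 3)
    have e1 : n + 1 + 1 + 1 + 1 = n + 1 + 3 := by omega
    have e2 : n + 1 + 1 + 1 + 2 = n + 2 + 3 := by omega
    have e3 : n + 1 + 1 + 1 + 3 = n + 3 + 3 := by omega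
    rw [e1, e2, e3, h1, h2, h3]
    push_cast
    have hn : (0 : ℝ) ≤ n := Nat.cast_nonneg _
    have : (1.0021 * (2 * ((n : ℝ) + 3) + 10) + 3.4 - (2 * ((n : ℝ) + 1) + 10)) / ((n : ℝ) + 1 + 1 + 1 + 2) ≤ 1.9 := by
      rw [div_le_iff₀ (by positivity)]
      nlinarith
    linarith

lemma hh_succ {g : ℕ} (hg : 1000 ≤ g) : hh g ≤ 1.0021 * hh (g + 1) := by
  unfold hh
  have h : (1000 : ℝ) ≤ g := by exact_mod_cast hg
  rw [← mul_div_assoc, div_le_div_iff₀ (by positivity) (by positivity)]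
  push_cast
  nlinarith

lemma hh_ten (g : ℕ) : 10 / ((g : ℝ) + 1) ^ 2 = 0.00001 * hh (g + 1) := by
  unfold hh; push_cast; field_simp; norm_num

lemma gam_nonneg (hc : RW c) (g : ℕ) : 0 ≤ gam c g := hc.nonneg (by simp)
lemma gam_le (hc : RW c) (g : ℕ) : gam c g ≤ 4 / 3 := hc.le_bound (by simp)

lemma exists_min {l : List ℕ} (hl : l ≠ []) : ∃ d ∈ l, ∀ x ∈ l, d ≤ x := by
  induction l with
  | nil => exact absurd rfl hl
  | cons a l ih =>
    by_cases h : l = []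
    · subst h; exact ⟨a, by simp, by simp⟩
    · obtain ⟨d, hd, hm⟩ := ih h
      by_cases hda : d ≤ a
      · refine ⟨d, List.mem_cons_of_mem _ hd, fun x hx => ?_⟩
        rcases List.mem_cons.1 hx with rfl | hx
        · exact hda
        · exact hm x hx
      · refine ⟨a, by simp, fun x hx => ?_⟩
        rcases List.mem_cons.1 hx with rfl | hx
        · exact le_rfl
        · have := hm x hx; omega

lemma wt_ge {d : ℕ} {l : List ℕ} (h : ∀ x ∈ l, d ≤ x) : l.length * (2 * d + 1) ≤ wt l := by
  induction l with
  | nil => simp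
  | cons a l ih =>
    have h1 := ih (fun x hx => h x (List.mem_cons_of_mem _ hx))
    have h2 := h a (by simp)
    rw [wt_cons, List.length_cons]
    nlinarith

lemma c_one {l : List ℕ} {g : ℕ} (hl : l.length = 1) (hg : Gen l g) : c l = gam c g := by
  obtain ⟨x, rfl⟩ := List.length_eq_one_iff.1 hl
  unfold Gen at hg
  simp at hg
  unfold gam
  congr 2
  omega

lemma H_step (hc : RW c) {g : ℕ} (hg : 1000 ≤ g) (hH : HH c g) (hJ : JJ c g) : HH c (g + 1) := by
  have key : ∀ n : ℕ, ∀ l : List ℕ, l.length = n + 1 → (∀ x ∈ l, 1 ≤ x) → Gen l (g + 1) →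
      |c l - gam c (g + 1)| ≤ phi (n + 1) * hh (g + 1) := by
    intro n
    induction n with
    | zero =>
      intro l hl _ hgl
      rw [c_one (c := c) (by omega) hgl]
      simp [phi]
    | succ n ih =>
      intro l hl hpos hgl
      have hne : l ≠ [] := by rintro rfl; simp at hl
      by_cases h1 : 1 ∈ l
      · have hp := perm_of_mem h1
        have hle := hp.length_eq
        have hg1 := gen_of_perm hp hgl
        have hw1 := hg1.wt_eq
        rw [List.length_cons] at hle
        simp only [wt_cons, List.length_cons] at hw1
        rw [hc.symm hp, hc.dilaton (X := 2 * g + (l.erase 1).length - 1) (by omega)]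
        refine (ih _ (by omega) (fun x hx => hpos x (List.mem_of_mem_erase hx)) ?_).trans ?_
        · unfold Gen at hg1 ⊢
          simp only [List.sum_cons, List.length_cons] at hg1
          omega
        · exact mul_le_mul_of_nonneg_right (phi_mono (by omega)) (hh_nonneg _)
      · have h2 := two_le_of_not_mem hpos h1
        obtain ⟨d, hd, hm⟩ := exists_min hne
        have hp := perm_of_mem hd
        set r := l.erase d
        have hle := hp.length_eq
        have hg1 := gen_of_perm hp hgl
        have hw0 := hgl.wt_eq
        have hw1 := wt_perm hp
        have hge := wt_ge hm
        rw [List.length_cons] at hle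
        have hr : ∀ x ∈ r, 2 ≤ x := fun x hx => h2 x (List.mem_of_mem_erase hx)
        obtain ⟨X, hX⟩ : ∃ X, X + 2 = 2 * g + l.length := ⟨2 * g + l.length - 2, by omega⟩
        have hw : wt (d :: r) = 3 * (X + 2) := by omega
        have hrl : r.length = n + 1 := by omega
        have st := one_step hc (h2 d hd) hr hg1 (by omega) hw (gam_nonneg hc g) (gam_le hc g)
          (mul_nonneg (phi_nonneg (n + 3)) (hh_nonneg g)) rfl (γ := gam c (g + 1))
          (B1 := phi (n + 1) * hh (g + 1))
          (fun l' hl' hp' hg' hlen => ih l' (by omega) hp' hg')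
          (fun l' hl' hp' hg' hlen => (hH l' hl' hp' hg').trans
            (mul_le_mul_of_nonneg_right (phi_mono (by omega)) (hh_nonneg _)))
        rw [hc.symm hp]
        refine st.trans ?_
        rw [hh_ten]
        unfold JJ at hJ
        have hs := hh_succ hg
        set q : ℝ := 2 * ((d : ℝ) - 1) / (3 * ((X : ℝ) + 1)) with hq
        have hd2 : (2 : ℝ) ≤ d := by exact_mod_cast h2 d hd
        have hq0 : 0 ≤ q := by rw [hq]; apply div_nonneg <;> [linarith; positivity]
        have hqn : q ≤ 1 / ((n : ℝ) + 2) := by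
          rw [hq, div_le_div_iff₀ (by positivity) (by positivity)]
          have : (((n : ℝ) + 2) * (2 * d + 1)) ≤ 3 * X + 6 := by
            rw [hl, hw1, hw] at hge
            have : (n + 1 + 1) * (2 * d + 1) ≤ 3 * X + 6 := by omega
            have h' : (((n + 1 + 1) * (2 * d + 1) : ℕ) : ℝ) ≤ ((3 * X + 6 : ℕ) : ℝ) := by exact_mod_cast this
            push_cast at h'
            linarith
          have hn : (0 : ℝ) ≤ n := Nat.cast_nonneg _
          nlinarith
        have h0 := hh_nonneg (g + 1)
        have ps := phi_step n
        have pm : phi (n + 1) ≤ phi (n + 3) := phi_mono (by omega)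
        have pn := phi_nonneg (n + 1)
        have pn3 := phi_nonneg (n + 3)
        set D : ℝ := 1.0021 * phi (n + 3) + 3.4 - phi (n + 1) with hD
        have hD0 : 0 ≤ D := by rw [hD]; linarith
        have hqD : q * D ≤ D / ((n : ℝ) + 2) := by
          have := mul_le_mul_of_nonneg_right hqn hD0
          rwa [one_div_mul_eq_div] at this
        have b1 : phi (n + 3) * hh g + |gam c (g + 1) - gam c g| ≤
            (D + phi (n + 1)) * hh (g + 1) := by
          have := mul_le_mul_of_nonneg_left hs pn3
          rw [hD]; linarith
        have b2 := mul_le_mul_of_nonneg_left b1 hq0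
        have b3 : (phi (n + 1) + q * D + 0.00001) * hh (g + 1) ≤ phi (n + 2) * hh (g + 1) :=
          mul_le_mul_of_nonneg_right (by linarith) h0
        have e : n + 1 + 1 = n + 2 := rfl
        rw [e]
        linarith
  intro l hl hp hgl
  have : 1 ≤ l.length := List.length_pos_iff.2 hl
  have h := key (l.length - 1) l (by omega) hp hgl
  rwa [Nat.sub_add_cancel this] at h

lemma two_min (hc : RW c) {k : ℕ} (hk : 1000 ≤ k) (hH : HH c k) (hJ : JJ c k) {m b : ℕ} (hm : 2 ≤ m)
    (hmb : m ≤ b) (hN : m + b = 3 * k + 2) :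
    |c [m, b] - gam c (k + 1)| ≤ 2 * (m : ℝ) / (6 * k + 3) * (10 * hh k + 3.4 * hh (k + 1))
      + 10 / ((k : ℝ) + 1) ^ 2 := by
  have hg1 : Gen [m, b] (k + 1) := by unfold Gen; simp; omega
  have hw : wt [m, b] = 3 * (2 * k + 2) := by simp [wt]; omega
  have st := one_step hc hm (r := [b]) (by simp; omega) hg1 (by omega) hw (gam_nonneg hc k) (gam_le hc k)
    (mul_nonneg (phi_nonneg 3) (hh_nonneg k)) rfl (γ := gam c (k + 1)) (B1 := 0)
    (fun l' hl' hp' hg' hlen => by rw [c_one (c := c) (by simpa using hlen) hg']; simp)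
    (fun l' hl' hp' hg' hlen => (hH l' hl' hp' hg').trans
      (mul_le_mul_of_nonneg_right (phi_mono (by simpa using hlen)) (hh_nonneg _)))
  refine st.trans ?_
  have e : phi 3 = 10 := by norm_num [phi]
  rw [e, mul_zero, zero_add]
  unfold JJ at hJ
  have h0 := hh_nonneg (k + 1)
  have h1 := hh_nonneg k
  have hm2 : (2 : ℝ) ≤ m := by exact_mod_cast hm
  apply add_le_add_left
  apply mul_le_mul _ (by linarith) (by positivity) (by positivity)
  push_cast
  have : 3 * (2 * (k : ℝ) + 1) = 6 * k + 3 := by ring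
  rw [this]
  apply div_le_div_of_nonneg_right _ (by positivity)
  linarith

lemma two_any (hc : RW c) {k : ℕ} (hk : 1000 ≤ k) (hH : HH c k) (hJ : JJ c k) {a b : ℕ}
    (hab : a ≤ b) (hN : a + b = 3 * k + 2) :
    |c [a, b] - gam c (k + 1)| ≤ 2 * (a : ℝ) / (6 * k + 3) * (10 * hh k + 3.4 * hh (k + 1))
      + 10 / ((k : ℝ) + 1) ^ 2 + (if a = 0 then 2 / ((k : ℝ) + 1) else 0) := by
  have h0 := hh_nonneg (k + 1)
  have h1 := hh_nonneg k
  have hg1 : Gen [a, b] (k + 1) := by unfold Gen; simp; omega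
  have hp1 : 0 ≤ 10 / ((k : ℝ) + 1) ^ 2 := by positivity
  rcases Nat.lt_or_ge a 2 with h | h
  · rcases Nat.lt_or_ge a 1 with h' | h'
    · obtain rfl : a = 0 := by omega
      have := Zasym hc (g := k + 1) (n := 1) (by omega) (gam_nonneg hc (k + 1)) (gam_le hc (k + 1)) le_rfl
        (fun l hl _ hg hlen => by
          have : 1 ≤ l.length := List.length_pos_iff.2 hl
          rw [c_one (c := c) (by omega) hg]; simp) 2 [0, b] (by simp) hg1 (by simp) (by simp; omega)
      have e : nz [0, b] = 1 := by
        rw [nz_cons_zero, nz_cons_pos (by omega)]; rfl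
      rw [e] at this
      simp at this ⊢
      linarith
    · obtain rfl : a = 1 := by omega
      have hx : Gen [b] (k + 1) := by unfold Gen; simp; omega
      rw [hc.dilaton (X := 2 * k) (by simp [wt]; omega), c_one (c := c) rfl hx]
      simp
      positivity
  · rw [if_neg (by omega), add_zero]
    exact two_min hc hk hH hJ h hab hN

lemma J_step (hc : RW c) {k : ℕ} (hk : 1000 ≤ k) (hH : HH c k) (hJ : JJ c k) : JJ c (k + 1) := by
  have h0 := hh_nonneg (k + 1)
  have h1 := hh_nonneg k
  set S := 10 * hh k + 3.4 * hh (k + 1) with hS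
  have hS0 : 0 ≤ S := by rw [hS]; linarith
  have hk' : (1000 : ℝ) ≤ k := by exact_mod_cast hk
  set t : ℝ := (k : ℝ) + 1 with ht
  have hterm : ∀ a ∈ Finset.range (3 * k + 3), |c [a, 3 * k + 2 - a] - gam c (k + 1)| ≤
      (min a (3 * k + 2 - a) : ℕ) * (2 / (6 * k + 3) * S) + (10 / t ^ 2 +
        ((if a = 0 then 2 / t else 0) + (if a = 3 * k + 2 then 2 / t else 0))) := by
    intro a ha
    rw [Finset.mem_range] at ha
    have ht0 : 0 ≤ 2 / t := by positivity
    rcases le_total a (3 * k + 2 - a) with h | h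
    · have := two_any hc hk hH hJ h (by omega)
      rw [min_eq_left h]
      refine this.trans ?_
      have e : 2 * (a : ℝ) / (6 * k + 3) * S = (a : ℝ) * (2 / (6 * k + 3) * S) := by ring
      rw [e]
      have : 0 ≤ (if a = 3 * k + 2 then 2 / t else 0) := by split_ifs <;> [exact ht0; exact le_rfl]
      linarith
    · have := two_any hc hk hH hJ h (by omega)
      rw [min_eq_right h, hc.symm (List.Perm.swap _ _ [])]
      refine this.trans ?_
      have e : 2 * ((3 * k + 2 - a : ℕ) : ℝ) / (6 * k + 3) * S = ((3 * k + 2 - a : ℕ) : ℝ) * (2 / (6 * k + 3) * S) := by ring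
      rw [e]
      have e2 : (if 3 * k + 2 - a = 0 then 2 / t else 0) = (if a = 3 * k + 2 then 2 / t else 0) := by
        by_cases h' : a = 3 * k + 2
        · rw [if_pos h', if_pos (by omega)]
        · rw [if_neg h', if_neg (by omega)]
      rw [e2]
      have : 0 ≤ (if a = 0 then 2 / t else 0) := by split_ifs <;> [exact ht0; exact le_rfl]
      linarith
  have hsum := Finset.sum_le_sum hterm
  rw [Finset.sum_add_distrib, Finset.sum_add_distrib, Finset.sum_add_distrib, Finset.sum_ite_eq',
    Finset.sum_ite_eq', if_pos (by simp), if_pos (by simp), ← Finset.sum_mul, Finset.sum_const,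
    Finset.card_range, nsmul_eq_mul, ← Nat.cast_sum] at hsum
  have hmin := sum_min (3 * k + 2)
  set M := ∑ a ∈ Finset.range (3 * k + 3), min a (3 * k + 2 - a) with hM
  have hmin' : 4 * (M : ℝ) ≤ (3 * k + 2) ^ 2 := by exact_mod_cast hmin
  have hg : Gen [3 * k + 4] (k + 2) := by unfold Gen; simp; omega
  have hw : wt [3 * k + 4] = 3 * (2 * k + 1 + 2) := by simp [wt]; omega
  have hd := hc.dvv' hw (by omega)
  have pr := prodT_le_four hc (G := k) hg hw (by simp)
  have pr0 := prodT_nonneg hc (3 * k + 4) [] (2 * k + 1)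
  set P := prodT c (3 * k + 4) [] (2 * k + 1)
  have eg : gam c (k + 1 + 1) = c [3 * k + 4] := by unfold gam; congr 2
  have er : 3 * k + 4 - 1 = 3 * k + 3 := by omega
  have ev : ∀ a, 3 * k + 4 - 2 - a = 3 * k + 2 - a := by omega
  simp only [picks, List.map_nil, List.sum_nil, zero_add, er, ev] at hd
  have eq : gam c (k + 1 + 1) - gam c (k + 1) =
      1 / (3 * t) * ∑ a ∈ Finset.range (3 * k + 3), (c [a, 3 * k + 2 - a] - gam c (k + 1)) + P := by
    rw [eg, hd, Finset.sum_sub_distrib, Finset.sum_const, Finset.card_range, nsmul_eq_mul, ht]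
    push_cast
    field_simp
    ring
  unfold JJ
  rw [eq]
  refine (abs_add_le _ _).trans ?_
  rw [abs_of_nonneg pr0, abs_mul, abs_of_pos (by positivity : (0 : ℝ) < 1 / (3 * t))]
  have b0 := (Finset.abs_sum_le_sum_abs (fun a => c [a, 3 * k + 2 - a] - gam c (k + 1))
    (Finset.range (3 * k + 3))).trans hsum
  have b1 := mul_le_mul_of_nonneg_left b0 (by positivity : (0 : ℝ) ≤ 1 / (3 * t))
  have b2 : 1 / (3 * t) * (M * (2 / (6 * k + 3) * S) + (((3 * k + 3 : ℕ) : ℝ) * (10 / t ^ 2) + (2 / t + 2 / t)))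
      = M * 2 / ((3 * t) * (6 * k + 3)) * S + (10 + 4 / 3) / t ^ 2 := by
    push_cast
    have : (3 : ℝ) * k + 3 = 3 * t := by rw [ht]; ring
    rw [this]
    have htp : t ≠ 0 := by positivity
    clear_value t
    field_simp
    ring
  have b3 : (M : ℝ) * 2 / ((3 * t) * (6 * k + 3)) ≤ 1 / 4 := by
    rw [div_le_div_iff₀ (by positivity) (by positivity), ht]
    nlinarith
  have b4 := mul_le_mul_of_nonneg_right b3 hS0
  have b5 : P ≤ 1 / t ^ 2 := by
    refine pr.trans ?_
    rw [div_le_div_iff₀ (by positivity) (by positivity), ht]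
    push_cast
    nlinarith
  have s1 := hh_succ hk
  have s2 := hh_succ (g := k + 1) (by omega)
  have b6 : (10 + 4 / 3) / t ^ 2 + 1 / t ^ 2 ≤ 0.00002 * hh (k + 1) := by
    unfold hh; push_cast; rw [← ht, ← add_div, ← mul_div_assoc]
    apply div_le_div_of_nonneg_right _ (by positivity)
    norm_num
  rw [b2] at b1
  have e : k + 1 + 1 = k + 1 + 1 := rfl
  have hb : S ≤ 13.43 * hh (k + 1) := by rw [hS]; linarith
  have : 1 / (3 * t) * |∑ a ∈ Finset.range (3 * k + 3), (c [a, 3 * k + 2 - a] - gam c (k + 1))| + P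
     ≤ 1 / 4 * S + 0.00002 * hh (k + 1) := by linarith
  linarith

lemma hh_small {g : ℕ} (h1 : 1 ≤ g) (h : g ≤ 1001) : 0.9 ≤ hh g := by
  unfold hh
  have a : (1 : ℝ) ≤ g := by exact_mod_cast h1
  have b : (g : ℝ) ≤ 1001 := by exact_mod_cast h
  rw [le_div_iff₀ (by positivity)]
  nlinarith

lemma H_small (hc : RW c) {g : ℕ} (h1 : 1 ≤ g) (h : g ≤ 1001) : HH c g := by
  intro l hl hp hg
  have hl1 : 1 ≤ l.length := List.length_pos_iff.2 hl
  by_cases h' : l.length = 1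
  · rw [c_one (c := c) h' hg]; simp [h', phi]
  · have a := hh_small h1 h
    have a1 := hc.nonneg hl
    have a2 := hc.pos_le_one hl hp
    have a3 := gam_nonneg hc g
    have a4 : gam c g ≤ 1 := hc.pos_le_one (by simp) (by simp; omega)
    have a5 : (7 : ℝ) ≤ phi l.length := by
      have := phi_mono (by omega : 2 ≤ l.length)
      norm_num [phi] at this ⊢
      exact this
    have : |c l - gam c g| ≤ 1 := by rw [abs_le]; constructor <;> linarith
    nlinarith

lemma J_small (hc : RW c) {g : ℕ} (h1 : 1 ≤ g) (h : g ≤ 1000) : JJ c g := by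
  have a := hh_small (g := g + 1) (by omega) (by omega)
  have a1 := gam_nonneg hc (g + 1)
  have a2 : gam c (g + 1) ≤ 1 := hc.pos_le_one (by simp) (by simp; omega)
  have a3 := gam_nonneg hc g
  have a4 : gam c g ≤ 1 := hc.pos_le_one (by simp) (by simp; omega)
  unfold JJ
  have : |gam c (g + 1) - gam c g| ≤ 1 := by rw [abs_le]; constructor <;> linarith
  linarith

lemma HJ_all (hc : RW c) : ∀ k : ℕ, HH c (k + 1) ∧ JJ c (k + 1) ∧ HH c (k + 2) := by
  intro k
  induction k with
  | zero => exact ⟨H_small hc (by omega) (by omega), J_small hc (by omega) (by omega),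
      H_small hc (by omega) (by omega)⟩
  | succ k ih =>
    obtain ⟨h1, h2, h3⟩ := ih
    have hj : JJ c (k + 1 + 1) := by
      rcases Nat.lt_or_ge (k + 1 + 1) 1001 with h | h
      · exact J_small hc (by omega) (by omega)
      · exact J_step hc (by omega) h1 h2
    refine ⟨h3, hj, ?_⟩
    rcases Nat.lt_or_ge (k + 1 + 2) 1002 with h | h
    · exact H_small hc (by omega) (by omega)
    · exact H_step hc (by omega) h3 hj

lemma gam_diff (hc : RW c) (g m : ℕ) : |gam c (g + 1 + m) - gam c (g + 1)| ≤
    3400000 / ((g : ℝ) + 1) - 3400000 / ((g : ℝ) + 1 + m) := by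
  induction m with
  | zero => simp
  | succ m ih =>
    have hj := (HJ_all hc (g + m)).2.1
    unfold JJ hh at hj
    have e : g + m + 1 = g + 1 + m := by omega
    rw [e] at hj
    have t := abs_add_le (gam c (g + 1 + m + 1) - gam c (g + 1 + m)) (gam c (g + 1 + m) - gam c (g + 1))
    rw [sub_add_sub_cancel] at t
    have : 3.4 * (1000000 / ((g + 1 + m + 1 : ℕ) : ℝ) ^ 2) ≤
        3400000 / ((g : ℝ) + 1 + m) - 3400000 / ((g : ℝ) + 1 + (m + 1 : ℕ)) := by
      push_cast
      set x : ℝ := (g : ℝ) + 1 + m with hx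
      have hx0 : 0 < x := by positivity
      have e1 : (g : ℝ) + 1 + (m + 1) = x + 1 := by rw [hx]; ring
      rw [e1, div_sub_div _ _ (by positivity) (by positivity), ← mul_div_assoc,
        div_le_div_iff₀ (by positivity) (by positivity)]
      nlinarith
    have e2 : g + 1 + (m + 1) = g + 1 + m + 1 := by omega
    rw [e2]
    linarith

theorem exists_limit (hc : RW c) : ∃ L : ℝ, 0 ≤ L ∧ L ≤ 4 / 3 ∧
    ∀ l : List ℕ, l ≠ [] → (∀ x ∈ l, 1 ≤ x) → ∀ g, 1 ≤ g → Gen l g → |c l - L| ≤ 30000000 / (g : ℝ) := by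
  have hd := gam_diff hc
  have hcau : CauchySeq (fun g => gam c (g + 1)) := by
    refine cauchySeq_of_le_tendsto_0' (fun g : ℕ => 3400000 / ((g : ℝ) + 1)) ?_ ?_
    · intro n m hnm
      obtain ⟨k, rfl⟩ := Nat.exists_eq_add_of_le hnm
      rw [dist_comm, Real.dist_eq]
      have := hd n k
      have e : n + k + 1 = n + 1 + k := by omega
      rw [e]
      have h0 : 0 ≤ 3400000 / ((n : ℝ) + 1 + k) := by positivity
      linarith
    · have := (tendsto_one_div_add_atTop_nhds_zero_nat (𝕜 := ℝ)).const_mul 3400000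
      simpa [div_eq_mul_inv] using this
  obtain ⟨L, hL⟩ := cauchySeq_tendsto_of_complete hcau
  have hgL : ∀ g : ℕ, |gam c (g + 1) - L| ≤ 3400000 / ((g : ℝ) + 1) := by
    intro g
    have t1 : Filter.Tendsto (fun m => |gam c (m + g + 1) - gam c (g + 1)|) Filter.atTop
        (nhds |L - gam c (g + 1)|) :=
      (((Filter.tendsto_add_atTop_iff_nat g).2 hL).sub_const _).abs
    rw [abs_sub_comm]
    refine le_of_tendsto t1 (Filter.Eventually.of_forall fun m => ?_)
    have := hd g m
    have e : m + g + 1 = g + 1 + m := by omega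
    rw [e]
    have h0 : 0 ≤ 3400000 / ((g : ℝ) + 1 + m) := by positivity
    linarith
  refine ⟨L, ge_of_tendsto' hL (fun g => gam_nonneg hc _), le_of_tendsto' hL (fun g => gam_le hc _), ?_⟩
  have key : ∀ n : ℕ, ∀ l : List ℕ, l.length ≤ n → l ≠ [] → (∀ x ∈ l, 1 ≤ x) → ∀ g, 1 ≤ g → Gen l g →
      |c l - L| ≤ 30000000 / (g : ℝ) := by
    intro n
    induction n with
    | zero => intro l hl hne; exact absurd (List.length_eq_zero_iff.1 (by omega)) hne
    | succ n ih =>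
      intro l hl hne hpos g hg1 hg
      have hll : 1 ≤ l.length := List.length_pos_iff.2 hne
      obtain ⟨k, rfl⟩ : ∃ k, g = k + 1 := ⟨g - 1, by omega⟩
      by_cases hl1 : l.length = 1
      · rw [c_one (c := c) hl1 hg]
        refine (hgL k).trans ?_
        push_cast
        apply div_le_div_of_nonneg_right (by norm_num) (by positivity)
      by_cases h1 : 1 ∈ l
      · have hp := perm_of_mem h1
        have hle := hp.length_eq
        have hg' := gen_of_perm hp hg
        have hw1 := hg'.wt_eq
        rw [List.length_cons] at hle
        simp only [wt_cons, List.length_cons] at hw1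
        rw [hc.symm hp, hc.dilaton (X := 2 * k + (l.erase 1).length - 1) (by omega)]
        refine ih _ (by omega) ?_ (fun x hx => hpos x (List.mem_of_mem_erase hx)) _ hg1 ?_
        · intro h; rw [h] at hle; simp at hle; omega
        · unfold Gen at hg' ⊢
          simp only [List.sum_cons, List.length_cons] at hg'
          omega
      · have h2 := two_mul_len_le (two_le_of_not_mem hpos h1)
        have hH := (HJ_all hc k).1 l hne hpos hg
        have hlen : l.length ≤ 3 * k := by unfold Gen at hg; omega
        have hp : phi l.length ≤ 7 * ((3 * k : ℕ) : ℝ) := by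
          refine (phi_mono hlen).trans ?_
          have : 2 ≤ 3 * k := by omega
          generalize 3 * k = j at this
          have hj : (2 : ℝ) ≤ j := by exact_mod_cast this
          unfold phi
          rw [if_neg (by omega)]
          split_ifs <;> linarith
        have t := abs_add_le (c l - gam c (k + 1)) (gam c (k + 1) - L)
        rw [sub_add_sub_cancel] at t
        have b := mul_le_mul_of_nonneg_right hp (hh_nonneg (k + 1))
        have b2 : 7 * ((3 * k : ℕ) : ℝ) * hh (k + 1) ≤ 21000000 / ((k : ℝ) + 1) := by
          unfold hh
          push_cast
          rw [← mul_div_assoc, div_le_div_iff₀ (by positivity) (by positivity)]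
          nlinarith [Nat.cast_nonneg (α := ℝ) k]
        have b3 := hgL k
        have b4 : 21000000 / ((k : ℝ) + 1) + 3400000 / ((k : ℝ) + 1) ≤ 30000000 / ((k + 1 : ℕ) : ℝ) := by
          rw [← add_div]; push_cast
          apply div_le_div_of_nonneg_right (by norm_num) (by positivity)
        linarith
  exact fun l hl hp g hg1 hg => key l.length l le_rfl hl hp g hg1 hg

theorem all_limit (hc : RW c) {L : ℝ} (h0 : 0 ≤ L) (h1 : L ≤ 4 / 3)
    (hL : ∀ l : List ℕ, l ≠ [] → (∀ x ∈ l, 1 ≤ x) → ∀ g, 1 ≤ g → Gen l g → |c l - L| ≤ 30000000 / (g : ℝ))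
    {l : List ℕ} (hl : l ≠ []) {g : ℕ} (hg2 : 2 ≤ g) (hg : Gen l g) :
    |c l - L| ≤ 30000000 / (g : ℝ) + 2 * (nz l : ℝ) ^ 2 / g := by
  exact Zasym hc hg2 h0 h1 (by positivity) (n := l.length)
    (fun l' hl' hp' hg' _ => hL l' hl' hp' g (by omega) hg') l.length l hl hg le_rfl (by omega)




/-- The weighted sum over lists `l` with `wt l = N`. -/
def EE : ℕ → (List ℕ → ℝ) → ℝ
  | 0, f => f []
  | N + 1, f => 2 / ((N : ℝ) + 1) * ∑ x : Fin ((N + 2) / 2), EE (N - 2 * x.val) (fun l => f (x.val :: l))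
termination_by N => N
decreasing_by omega

/-- The entries that can occur in a list of weight `N`. -/
def od (N : ℕ) : Finset ℕ := Finset.range ((N + 1) / 2)

lemma mem_od {N x : ℕ} : x ∈ od N ↔ 2 * x + 1 ≤ N := by
  unfold od; rw [Finset.mem_range]; omega

lemma EE_zero (f : List ℕ → ℝ) : EE 0 f = f [] := by rw [EE]

lemma EE_pos {N : ℕ} (hN : 1 ≤ N) (f : List ℕ → ℝ) :
    EE N f = 2 / (N : ℝ) * ∑ x ∈ od N, EE (N - (2 * x + 1)) (fun l => f (x :: l)) := by
  obtain ⟨N, rfl⟩ : ∃ k, N = k + 1 := ⟨N - 1, by omega⟩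
  rw [EE]
  push_cast
  congr 1
  unfold od
  rw [Finset.sum_range (n := (N + 1 + 1) / 2)]

lemma EE_half (N : ℕ) (f : List ℕ → ℝ) :
    ∑ x ∈ od N, EE (N - (2 * x + 1)) (fun l => f (x :: l)) = N / 2 * EE N f := by
  rcases Nat.eq_zero_or_pos N with rfl | h
  · simp [od]
  · rw [EE_pos h]
    have : (N : ℝ) ≠ 0 := by positivity
    field_simp

lemma EE_mono : ∀ (N : ℕ) (f k : List ℕ → ℝ), (∀ l, wt l = N → f l ≤ k l) → EE N f ≤ EE N k := by
  intro N
  induction N using Nat.strong_induction_on with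
  | _ N ih =>
    intro f k h
    rcases Nat.eq_zero_or_pos N with rfl | hN
    · rw [EE_zero, EE_zero]; exact h [] rfl
    · rw [EE_pos hN, EE_pos hN]
      apply mul_le_mul_of_nonneg_left _ (by positivity)
      apply Finset.sum_le_sum
      intro x hx
      rw [mem_od] at hx
      apply ih _ (by omega)
      intro l hl
      apply h
      rw [wt_cons]; omega

lemma EE_congr {N : ℕ} {f k : List ℕ → ℝ} (h : ∀ l, wt l = N → f l = k l) : EE N f = EE N k :=
  le_antisymm (EE_mono N f k (fun l hl => (h l hl).le)) (EE_mono N k f (fun l hl => (h l hl).ge))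

lemma EE_add : ∀ (N : ℕ) (f k : List ℕ → ℝ), EE N (fun l => f l + k l) = EE N f + EE N k := by
  intro N
  induction N using Nat.strong_induction_on with
  | _ N ih =>
    intro f k
    rcases Nat.eq_zero_or_pos N with rfl | hN
    · simp [EE_zero]
    · rw [EE_pos hN, EE_pos hN, EE_pos hN, ← mul_add, ← Finset.sum_add_distrib]
      congr 1
      apply Finset.sum_congr rfl
      intro x hx
      rw [mem_od] at hx
      exact ih _ (by omega) _ _

lemma EE_smul : ∀ (N : ℕ) (a : ℝ) (f : List ℕ → ℝ), EE N (fun l => a * f l) = a * EE N f := by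
  intro N
  induction N using Nat.strong_induction_on with
  | _ N ih =>
    intro a f
    rcases Nat.eq_zero_or_pos N with rfl | hN
    · simp [EE_zero]
    · rw [EE_pos hN, EE_pos hN, mul_left_comm, Finset.mul_sum (a := a)]
      congr 1
      apply Finset.sum_congr rfl
      intro x hx
      rw [mem_od] at hx
      exact ih _ (by omega) _ _

lemma EE_fzero (N : ℕ) : EE N (fun _ => 0) = 0 := by
  have := EE_smul N 0 (fun _ => 0)
  simpa using this

lemma EE_sum (N : ℕ) {ι : Type*} (s : Finset ι) (f : ι → List ℕ → ℝ) :
    EE N (fun l => ∑ i ∈ s, f i l) = ∑ i ∈ s, EE N (f i) := by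
  classical
  induction s using Finset.induction_on with
  | empty => simp [EE_fzero]
  | insert i s hi ih =>
    rw [Finset.sum_insert hi, ← ih, ← EE_add]
    congr 1
    funext l
    rw [Finset.sum_insert hi]

lemma EE_one_aux (N : ℕ) : ∑ x ∈ od N, (if N = 2 * x + 1 then (1 : ℝ) else 2) = N := by
  induction N using Nat.twoStepInduction with
  | zero => simp [od]
  | one => simp [od]
  | more N ih _ =>
    unfold od at ih ⊢
    have e : (N + 2 + 1) / 2 = (N + 1) / 2 + 1 := by omega
    rw [e, Finset.sum_range_succ']
    have : ∀ x ∈ Finset.range ((N + 1) / 2), (if N + 2 = 2 * (x + 1) + 1 then (1 : ℝ) else 2)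
        = if N = 2 * x + 1 then (1 : ℝ) else 2 := by
      intro x _
      congr 1
      apply propext; omega
    rw [Finset.sum_congr rfl this, ih, if_neg (by omega)]
    push_cast; ring

lemma EE_one (N : ℕ) : EE N (fun _ => 1) = if N = 0 then 1 else 2 := by
  induction N using Nat.strong_induction_on with
  | _ N ih =>
    rcases Nat.eq_zero_or_pos N with rfl | hN
    · simp [EE_zero]
    · rw [EE_pos hN, if_neg (by omega)]
      have : ∀ x ∈ od N, EE (N - (2 * x + 1)) (fun _ => 1) = if N = 2 * x + 1 then (1 : ℝ) else 2 := by
        intro x hx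
        rw [mem_od] at hx
        rw [ih _ (by omega)]
        congr 1
        apply propext; omega
      rw [Finset.sum_congr rfl this, EE_one_aux]
      have : (N : ℝ) ≠ 0 := by positivity
      field_simp

lemma EE_one_le (N : ℕ) : EE N (fun _ => 1) ≤ 2 := by
  rw [EE_one]; split_ifs <;> norm_num

lemma od_comm (N : ℕ) (F : ℕ → ℕ → ℝ) :
    ∑ x ∈ od N, ∑ y ∈ od (N - (2 * x + 1)), F x y = ∑ y ∈ od N, ∑ x ∈ od (N - (2 * y + 1)), F x y := by
  apply Finset.sum_comm'
  intro x y
  simp only [mem_od]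
  omega

lemma EE_palm : ∀ (N : ℕ) (G : ℕ → List ℕ → ℝ),
    EE N (fun l => ((picks l).map (fun p => (2 * (p.1 : ℝ) + 1) * G p.1 p.2)).sum)
      = 2 * ∑ e ∈ od N, EE (N - (2 * e + 1)) (G e) := by
  intro N
  induction N using Nat.strong_induction_on with
  | _ N ih =>
    intro G
    rcases Nat.eq_zero_or_pos N with rfl | hN
    · simp [EE_zero, picks, od]
    · rw [EE_pos hN]
      have h1 : ∀ x ∈ od N, EE (N - (2 * x + 1)) (fun l => ((picks (x :: l)).map
            (fun p => (2 * (p.1 : ℝ) + 1) * G p.1 p.2)).sum)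
          = (2 * (x : ℝ) + 1) * EE (N - (2 * x + 1)) (G x) +
            2 * ∑ e ∈ od (N - (2 * x + 1)), EE (N - (2 * x + 1) - (2 * e + 1)) (fun l => G e (x :: l)) := by
        intro x hx
        rw [mem_od] at hx
        rw [← ih _ (by omega) (fun e l => G e (x :: l)), ← EE_smul, ← EE_add]
        apply EE_congr
        intro l _
        simp only [picks, List.map_cons, List.sum_cons, List.map_map]
        rfl
      rw [Finset.sum_congr rfl h1, Finset.sum_add_distrib, ← Finset.mul_sum, od_comm]
      have h2 : ∀ e ∈ od N, ∑ x ∈ od (N - (2 * e + 1)), EE (N - (2 * x + 1) - (2 * e + 1)) (fun l => G e (x :: l))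
          = ((N : ℝ) - (2 * e + 1)) / 2 * EE (N - (2 * e + 1)) (G e) := by
        intro e he
        rw [mem_od] at he
        have := EE_half (N - (2 * e + 1)) (G e)
        rw [Nat.cast_sub he] at this
        push_cast at this
        rw [← this]
        apply Finset.sum_congr rfl
        intro x _
        congr 1
        omega
      rw [Finset.sum_congr rfl h2, Finset.mul_sum, ← Finset.sum_add_distrib, Finset.mul_sum, Finset.mul_sum]
      apply Finset.sum_congr rfl
      intro e _
      have : (N : ℝ) ≠ 0 := by positivity
      field_simp
      ring

/-- convolution rearrangements -/
lemma conv_left (n : ℕ) (P : List ℕ → ℝ) (W : ℕ → ℝ) :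
    ∑ x ∈ od n, ∑ k ∈ Finset.range (n - (2 * x + 1) + 1),
        EE k (fun l => P (x :: l)) * W (n - (2 * x + 1) - k)
      = ∑ k ∈ Finset.range (n + 1), (k : ℝ) / 2 * EE k P * W (n - k) := by
  have h1 : ∀ x ∈ od n, ∑ k ∈ Finset.range (n - (2 * x + 1) + 1),
        EE k (fun l => P (x :: l)) * W (n - (2 * x + 1) - k)
      = ∑ k ∈ Finset.range (n - (2 * x + 1) + 1), EE (n - k - (2 * x + 1)) (fun l => P (x :: l)) * W k := by
    intro x hx
    rw [← Finset.sum_range_reflect]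
    apply Finset.sum_congr rfl
    intro k hk
    rw [Finset.mem_range] at hk
    congr 2 <;> omega
  rw [Finset.sum_congr rfl h1, Finset.sum_comm' (t' := Finset.range (n + 1)) (s' := fun k => od (n - k))
    (by intro x k; simp only [mem_od, Finset.mem_range]; omega)]
  rw [← Finset.sum_range_reflect]
  apply Finset.sum_congr rfl
  intro k hk
  rw [Finset.mem_range] at hk
  have e : n + 1 - 1 - k = n - k := by omega
  have e2 : n - (n - k) = k := by omega
  rw [e, ← Finset.sum_mul, e2, EE_half]

lemma conv_right (n : ℕ) (Q : List ℕ → ℝ) (W : ℕ → ℝ) :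
    ∑ x ∈ od n, ∑ k ∈ Finset.range (n - (2 * x + 1) + 1),
        W k * EE (n - (2 * x + 1) - k) (fun l => Q (x :: l))
      = ∑ k ∈ Finset.range (n + 1), W k * (((n - k : ℕ) : ℝ) / 2 * EE (n - k) Q) := by
  rw [Finset.sum_comm' (t' := Finset.range (n + 1)) (s' := fun k => od (n - k))
    (by intro x k; simp only [mem_od, Finset.mem_range]; omega)]
  apply Finset.sum_congr rfl
  intro k hk
  rw [← EE_half, Finset.mul_sum]
  apply Finset.sum_congr rfl
  intro x _
  congr 2
  omega

lemma EE_split : ∀ (N : ℕ) (P Q : List ℕ → ℝ),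
    EE N (fun l => ((splits l).map (fun p => P p.1 * Q p.2)).sum)
      = ∑ k ∈ Finset.range (N + 1), EE k P * EE (N - k) Q := by
  intro N
  induction N using Nat.strong_induction_on with
  | _ N ih =>
    intro P Q
    rcases Nat.eq_zero_or_pos N with rfl | hN
    · simp [EE_zero, splits]
    · rw [EE_pos hN]
      have h1 : ∀ x ∈ od N, EE (N - (2 * x + 1)) (fun l => ((splits (x :: l)).map
            (fun p => P p.1 * Q p.2)).sum)
          = ∑ k ∈ Finset.range (N - (2 * x + 1) + 1), EE k (fun l => P (x :: l)) * EE (N - (2 * x + 1) - k) Q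
            + ∑ k ∈ Finset.range (N - (2 * x + 1) + 1), EE k P * EE (N - (2 * x + 1) - k) (fun l => Q (x :: l)) := by
        intro x hx
        rw [mem_od] at hx
        rw [← ih _ (by omega) (fun l => P (x :: l)) Q, ← ih _ (by omega) P (fun l => Q (x :: l)), ← EE_add]
        apply EE_congr
        intro l _
        simp only [splits, List.map_append, List.sum_append, List.map_map]
        rfl
      rw [Finset.sum_congr rfl h1, Finset.sum_add_distrib, conv_left N P (fun m => EE m Q),
        conv_right N Q (fun m => EE m P), ← Finset.sum_add_distrib, Finset.mul_sum]
      apply Finset.sum_congr rfl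
      intro k hk
      rw [Finset.mem_range] at hk
      rw [Nat.cast_sub (by omega)]
      have : (N : ℝ) ≠ 0 := by positivity
      field_simp
      ring

lemma od_pairs (M : ℕ) (F : ℕ → ℕ → ℝ) :
    ∑ d ∈ od (M + 3), ∑ a ∈ Finset.range (d - 1), F a (d - 2 - a)
      = ∑ a ∈ od M, ∑ b ∈ od (M - (2 * a + 1)), F a b := by
  rw [Finset.sum_sigma', Finset.sum_sigma']
  refine Finset.sum_nbij' (fun p => ⟨p.2, p.1 - 2 - p.2⟩) (fun p => ⟨p.1 + p.2 + 2, p.1⟩) ?_ ?_ ?_ ?_ ?_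
  · rintro ⟨d, a⟩ h
    simp only [Finset.mem_sigma, mem_od, Finset.mem_range] at h ⊢
    omega
  · rintro ⟨d, a⟩ h
    simp only [Finset.mem_sigma, mem_od, Finset.mem_range] at h ⊢
    omega
  · rintro ⟨d, a⟩ h
    simp only [Finset.mem_sigma, mem_od, Finset.mem_range] at h ⊢
    have : a + (d - 2 - a) + 2 = d := by omega
    rw [this]
  · rintro ⟨a, b⟩ h
    simp only [Finset.mem_sigma, mem_od, Finset.mem_range] at h ⊢
    have : a + b + 2 - 2 - a = b := by omega
    rw [this]
  · rintro ⟨d, a⟩ h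
    rfl

lemma od_sums (M : ℕ) (F : ℕ → ℝ) :
    ∑ d ∈ od (M + 3), ∑ e ∈ od (M + 3 - (2 * d + 1)), (if 1 ≤ d + e then F (d + e - 1) else 0)
      = ∑ t ∈ od M, ((t : ℝ) + 2) * F t := by
  have h1 : ∑ d ∈ od (M + 3), ∑ e ∈ od (M + 3 - (2 * d + 1)), (if 1 ≤ d + e then F (d + e - 1) else 0)
      = ∑ s ∈ od (M + 2), ∑ _d ∈ Finset.range (s + 1), (if 1 ≤ s then F (s - 1) else 0) := by
    rw [Finset.sum_sigma', Finset.sum_sigma']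
    refine Finset.sum_nbij' (fun p => ⟨p.1 + p.2, p.1⟩) (fun p => ⟨p.2, p.1 - p.2⟩) ?_ ?_ ?_ ?_ ?_
    · rintro ⟨d, a⟩ h
      simp only [Finset.mem_sigma, mem_od, Finset.mem_range] at h ⊢
      omega
    · rintro ⟨d, a⟩ h
      simp only [Finset.mem_sigma, mem_od, Finset.mem_range] at h ⊢
      omega
    · rintro ⟨d, a⟩ h
      have : d + a - d = a := by omega
      simp only [this]
    · rintro ⟨s, d⟩ h
      simp only [Finset.mem_sigma, mem_od, Finset.mem_range] at h ⊢
      have : d + (s - d) = s := by omega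
      rw [this]
    · rintro ⟨d, a⟩ h
      rfl
  rw [h1]
  unfold od
  have e : (M + 2 + 1) / 2 = (M + 1) / 2 + 1 := by omega
  rw [e, Finset.sum_range_succ']
  simp only [Finset.sum_const, Finset.card_range, nsmul_eq_mul]
  rw [if_neg (by omega), mul_zero, add_zero]
  apply Finset.sum_congr rfl
  intro t _
  rw [if_pos (by omega)]
  push_cast
  congr 1
  ring

lemma sum_mult_three (f : ℕ → ℝ) (h : ∀ k, ¬ 3 ∣ k → f k = 0) (n : ℕ) :
    ∑ k ∈ Finset.range (3 * n + 1), f k = ∑ i ∈ Finset.range (n + 1), f (3 * i) := by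
  induction n with
  | zero => simp
  | succ n ih =>
    have e : 3 * (n + 1) + 1 = 3 * n + 1 + 1 + 1 + 1 := by ring
    rw [e, Finset.sum_range_succ, Finset.sum_range_succ, Finset.sum_range_succ, ih,
      Finset.sum_range_succ _ (n + 1), h (3 * n + 1) (by omega), h (3 * n + 1 + 1) (by omega)]
    have e2 : 3 * n + 1 + 1 + 1 = 3 * (n + 1) := by ring
    rw [e2]; ring

/-- The averaged numbers. -/
def AA (c : List ℕ → ℝ) (X : ℕ) : ℝ := EE (3 * X) c

/-- Factorially rescaled averaged numbers. -/
def aa (c : List ℕ → ℝ) (X : ℕ) : ℝ := if X = 0 then 0 else (X.factorial : ℝ) * AA c X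

lemma EE_vanish (hc : RW c) {k : ℕ} (h : ¬ 3 ∣ k) : EE k c = 0 := by
  rw [← EE_fzero k]
  apply EE_congr
  intro l hl
  apply hc.vanish
  rintro ⟨g, hg⟩
  have := hg.wt_eq
  omega

/-- The factor in the product terms. -/
def PP (c : List ℕ → ℝ) (l : List ℕ) : ℝ := ((wt l / 3 - 1).factorial : ℝ) * c l

lemma EE_PP (k : ℕ) : EE k (PP c) = ((k / 3 - 1).factorial : ℝ) * EE k c := by
  rw [← EE_smul]
  apply EE_congr
  intro l hl
  unfold PP; rw [hl]

lemma half_PP (k : ℕ) : ((3 * k : ℕ) : ℝ) / 2 * EE (3 * k) (PP c) = 3 / 2 * aa c k := by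
  rw [EE_PP]
  unfold aa AA
  rcases k with _ | k
  · simp
  · have e : 3 * (k + 1) / 3 - 1 = k := by omega
    rw [e, if_neg (by omega), Nat.factorial_succ]
    push_cast
    ring

lemma T3_eq (hc : RW c) (X : ℕ) :
    ∑ d ∈ od (3 * (X + 1) + 3), EE (3 * (X + 1) + 3 - (2 * d + 1)) (fun r => ∑ a ∈ Finset.range (d - 1),
          ((splits r).map (fun p => PP c (a :: p.1) * PP c ((d - 2 - a) :: p.2))).sum)
      = 9 / 4 * ∑ i ∈ Finset.range (X + 2), aa c i * aa c (X + 1 - i) := by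
  set n := 3 * (X + 1) with hn
  have h1 : ∀ d ∈ od (n + 3), EE (n + 3 - (2 * d + 1)) (fun r => ∑ a ∈ Finset.range (d - 1),
          ((splits r).map (fun p => PP c (a :: p.1) * PP c ((d - 2 - a) :: p.2))).sum)
      = ∑ a ∈ Finset.range (d - 1), (fun a b => ∑ k ∈ Finset.range (n - (2 * a + 1) - (2 * b + 1) + 1),
          EE k (fun s => PP c (a :: s)) * EE (n - (2 * a + 1) - (2 * b + 1) - k) (fun s => PP c (b :: s)))
            a (d - 2 - a) := by
    intro d hd
    rw [mem_od] at hd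
    rw [EE_sum]
    apply Finset.sum_congr rfl
    intro a ha
    rw [Finset.mem_range] at ha
    rw [EE_split _ (fun s => PP c (a :: s)) (fun s => PP c ((d - 2 - a) :: s))]
    have e : n + 3 - (2 * d + 1) = n - (2 * a + 1) - (2 * (d - 2 - a) + 1) := by omega
    rw [e]
  rw [Finset.sum_congr rfl h1, od_pairs n (fun a b => ∑ k ∈ Finset.range (n - (2 * a + 1) - (2 * b + 1) + 1),
          EE k (fun s => PP c (a :: s)) * EE (n - (2 * a + 1) - (2 * b + 1) - k) (fun s => PP c (b :: s)))]
  have h2 : ∀ a ∈ od n, ∑ b ∈ od (n - (2 * a + 1)), ∑ k ∈ Finset.range (n - (2 * a + 1) - (2 * b + 1) + 1),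
          EE k (fun s => PP c (a :: s)) * EE (n - (2 * a + 1) - (2 * b + 1) - k) (fun s => PP c (b :: s))
      = ∑ k ∈ Finset.range (n - (2 * a + 1) + 1), EE k (fun s => PP c (a :: s)) *
          (fun m : ℕ => (m : ℝ) / 2 * EE m (PP c)) (n - (2 * a + 1) - k) := by
    intro a _
    exact conv_right (n - (2 * a + 1)) (PP c) (fun k => EE k (fun s => PP c (a :: s)))
  rw [Finset.sum_congr rfl h2, conv_left n (PP c) (fun m : ℕ => (m : ℝ) / 2 * EE m (PP c)), hn,
    sum_mult_three, Finset.mul_sum]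
  · apply Finset.sum_congr rfl
    intro i hi
    rw [← Nat.mul_sub, half_PP, half_PP]
    ring
  · intro k hk
    rw [EE_PP, EE_vanish hc hk]
    ring

lemma T12_eq (X : ℕ) :
    ∑ d ∈ od (3 * (X + 1) + 3), EE (3 * (X + 1) + 3 - (2 * d + 1)) (fun r =>
        ((picks r).map (fun p => (2 * (p.1 : ℝ) + 1) *
            (if 1 ≤ d + p.1 then c ((d + p.1 - 1) :: p.2) else 0))).sum
          + 2 * ∑ a ∈ Finset.range (d - 1), c (a :: (d - 2 - a) :: r))
      = (3 * ((X : ℝ) + 2)) * (3 * ((X : ℝ) + 1)) / 2 * AA c (X + 1) := by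
  unfold AA
  set n := 3 * (X + 1) with hn
  have h1 : ∀ d ∈ od (n + 3), EE (n + 3 - (2 * d + 1)) (fun r =>
        ((picks r).map (fun p => (2 * (p.1 : ℝ) + 1) *
            (if 1 ≤ d + p.1 then c ((d + p.1 - 1) :: p.2) else 0))).sum
          + 2 * ∑ a ∈ Finset.range (d - 1), c (a :: (d - 2 - a) :: r))
      = 2 * ∑ e ∈ od (n + 3 - (2 * d + 1)), (if 1 ≤ d + e then
            (fun t => EE (n - (2 * t + 1)) (fun s => c (t :: s))) (d + e - 1) else 0)
        + 2 * ∑ a ∈ Finset.range (d - 1), (fun a b => EE (n - (2 * a + 1) - (2 * b + 1))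
            (fun s => c (a :: b :: s))) a (d - 2 - a) := by
    intro d hd
    rw [mem_od] at hd
    rw [EE_add, EE_smul, EE_sum, EE_palm _ (fun e s => if 1 ≤ d + e then c ((d + e - 1) :: s) else 0)]
    congr 1
    · congr 1
      apply Finset.sum_congr rfl
      intro e he
      rw [mem_od] at he
      split_ifs with h
      · have : n + 3 - (2 * d + 1) - (2 * e + 1) = n - (2 * (d + e - 1) + 1) := by omega
        rw [this]
      · rw [EE_fzero]
    · congr 1
      apply Finset.sum_congr rfl
      intro a ha
      rw [Finset.mem_range] at ha
      have e : n + 3 - (2 * d + 1) = n - (2 * a + 1) - (2 * (d - 2 - a) + 1) := by omega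
      rw [e]
  rw [Finset.sum_congr rfl h1, Finset.sum_add_distrib, ← Finset.mul_sum, ← Finset.mul_sum,
    od_pairs n (fun a b => EE (n - (2 * a + 1) - (2 * b + 1)) (fun s => c (a :: b :: s))),
    od_sums n (fun t => EE (n - (2 * t + 1)) (fun s => c (t :: s)))]
  have h2 : ∀ a ∈ od n, ∑ b ∈ od (n - (2 * a + 1)), EE (n - (2 * a + 1) - (2 * b + 1)) (fun s => c (a :: b :: s))
      = ((n : ℝ) - (2 * a + 1)) / 2 * EE (n - (2 * a + 1)) (fun s => c (a :: s)) := by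
    intro a ha
    rw [mem_od] at ha
    rw [EE_half (n - (2 * a + 1)) (fun s => c (a :: s)), Nat.cast_sub ha]
    push_cast
    rfl
  rw [Finset.sum_congr rfl h2, ← mul_add, ← Finset.sum_add_distrib]
  have h3 : ∀ a ∈ od n, ((a : ℝ) + 2) * EE (n - (2 * a + 1)) (fun s => c (a :: s)) +
      ((n : ℝ) - (2 * a + 1)) / 2 * EE (n - (2 * a + 1)) (fun s => c (a :: s))
      = ((n : ℝ) + 3) / 2 * EE (n - (2 * a + 1)) (fun s => c (a :: s)) := by
    intro a _; ring
  rw [Finset.sum_congr rfl h3, ← Finset.mul_sum, EE_half, hn]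
  push_cast
  ring

lemma AA_rec (hc : RW c) (X : ℕ) : AA c (X + 2) = AA c (X + 1) +
    1 / (4 * ((X + 2).factorial : ℝ)) * ∑ i ∈ Finset.range (X + 2), aa c i * aa c (X + 1 - i) := by
  have h3 := T3_eq hc X
  have h12 := T12_eq (c := c) X
  have e0 : 3 * (X + 2) = 3 * (X + 1) + 3 := by ring
  unfold AA at h12 ⊢
  rw [e0, EE_pos (by omega)]
  have h1 : ∀ d ∈ od (3 * (X + 1) + 3), EE (3 * (X + 1) + 3 - (2 * d + 1)) (fun r => c (d :: r))
      = 1 / (3 * ((X : ℝ) + 1)) * EE (3 * (X + 1) + 3 - (2 * d + 1)) (fun r =>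
        ((picks r).map (fun p => (2 * (p.1 : ℝ) + 1) *
            (if 1 ≤ d + p.1 then c ((d + p.1 - 1) :: p.2) else 0))).sum
          + 2 * ∑ a ∈ Finset.range (d - 1), c (a :: (d - 2 - a) :: r))
        + 1 / (6 * ((X + 1).factorial : ℝ)) * EE (3 * (X + 1) + 3 - (2 * d + 1)) (fun r => ∑ a ∈ Finset.range (d - 1),
          ((splits r).map (fun p => PP c (a :: p.1) * PP c ((d - 2 - a) :: p.2))).sum) := by
    intro d hd
    rw [mem_od] at hd
    rw [← EE_smul, ← EE_smul, ← EE_add]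
    apply EE_congr
    intro r hr
    exact hc.dvv d r X (by rw [wt_cons]; omega)
  rw [Finset.sum_congr rfl h1, Finset.sum_add_distrib, ← Finset.mul_sum, ← Finset.mul_sum, h12, h3,
    Nat.factorial_succ (X + 1)]
  have : ((X + 1).factorial : ℝ) ≠ 0 := by positivity
  push_cast
  field_simp
  ring

lemma AA_one (hc : RW c) : AA c 1 = 5 / 9 := by
  unfold AA
  have h1 : od 1 = {0} := by rfl
  have h2 : od 2 = {0} := by rfl
  have h3 : od 3 = {0, 1} := by rfl
  rw [EE_pos (by norm_num), h3, Finset.sum_pair (by norm_num)]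
  norm_num
  rw [EE_zero, EE_pos (by norm_num), h2, Finset.sum_singleton]
  norm_num
  rw [EE_pos (by norm_num), h1, Finset.sum_singleton]
  norm_num
  rw [EE_zero, hc.init1, hc.init3]
  norm_num

lemma aa_rec (hc : RW c) (X : ℕ) : aa c (X + 2) = ((X : ℝ) + 2) * aa c (X + 1) +
    1 / 4 * ∑ i ∈ Finset.range (X + 2), aa c i * aa c (X + 1 - i) := by
  have h := AA_rec hc X
  set S := ∑ i ∈ Finset.range (X + 2), aa c i * aa c (X + 1 - i)
  unfold aa
  rw [if_neg (by omega), if_neg (by omega), h, Nat.factorial_succ (X + 1)]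
  have : ((X + 1).factorial : ℝ) ≠ 0 := by positivity
  push_cast
  field_simp
  ring




/-- The Airy-type coefficients. -/
def uc : ℕ → ℝ
  | 0 => 1
  | k + 1 => ((k : ℝ) + 1 / 6) * ((k : ℝ) + 5 / 6) / ((k : ℝ) + 1) * uc k

/-- The Euler operator on power series. -/
def thet (f : PowerSeries ℝ) : PowerSeries ℝ := PowerSeries.X * PowerSeries.derivative ℝ f

lemma coeff_thet (f : PowerSeries ℝ) (n : ℕ) :
    PowerSeries.coeff n (thet f) = n * PowerSeries.coeff n f := by
  unfold thet
  rcases n with _ | n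
  · simp
  · rw [PowerSeries.coeff_succ_X_mul, PowerSeries.coeff_derivative]
    push_cast; ring

lemma thet_mul (f k : PowerSeries ℝ) : thet (f * k) = thet f * k + f * thet k := by
  unfold thet
  rw [Derivation.leibniz]
  simp only [smul_eq_mul]
  ring

lemma thet_sub (f k : PowerSeries ℝ) : thet (f - k) = thet f - thet k := by
  ext n
  simp only [coeff_thet, map_sub]; ring

lemma thet_C (a : ℝ) (f : PowerSeries ℝ) : thet (PowerSeries.C a * f) = PowerSeries.C a * thet f := by
  ext n
  simp only [coeff_thet, PowerSeries.coeff_C_mul]; ring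

lemma D_zero {p D : PowerSeries ℝ} (h : D = PowerSeries.X * (thet D + D + PowerSeries.C (1 / 4) * (p * D))) :
    D = 0 := by
  have : ∀ n, ∀ m ≤ n, PowerSeries.coeff m D = 0 := by
    intro n
    induction n with
    | zero =>
      intro m hm
      obtain rfl : m = 0 := by omega
      rw [h]; simp
    | succ n ih =>
      intro m hm
      rcases Nat.lt_or_ge m (n + 1) with h' | h'
      · exact ih m (by omega)
      obtain rfl : m = n + 1 := by omega
      rw [h, PowerSeries.coeff_succ_X_mul, map_add, map_add, coeff_thet, PowerSeries.coeff_C_mul,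
        PowerSeries.coeff_mul, ih n le_rfl, Finset.sum_eq_zero]
      · simp
      · intro x hx
        rw [Finset.HasAntidiagonal.mem_antidiagonal] at hx
        rw [ih x.2 (by omega), mul_zero]
  ext n
  simpa using this n n le_rfl

lemma conv_identity (hc : RW c) (X : ℕ) :
    ∑ i ∈ Finset.range (X + 1), aa c i * uc (X - i) = 4 * X * uc X := by
  set p : PowerSeries ℝ := PowerSeries.mk (aa c) with hp
  set y : PowerSeries ℝ := PowerSeries.mk uc with hy
  have e1 : p = PowerSeries.X * (PowerSeries.C (5 / 9) + p + thet p + PowerSeries.C (1 / 4) * (p * p)) := by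
    ext n
    rcases n with _ | _ | n
    · simp [hp, aa]
    · rw [PowerSeries.coeff_succ_X_mul]
      have t0 : PowerSeries.constantCoeff (thet p) = 0 := by simp [thet]
      simp [t0]
      simp [hp, aa, AA_one hc]
    · rw [PowerSeries.coeff_succ_X_mul, map_add, map_add, map_add, coeff_thet, PowerSeries.coeff_C_mul,
        PowerSeries.coeff_mul, Finset.Nat.sum_antidiagonal_eq_sum_range_succ_mk]
      simp only [hp, PowerSeries.coeff_mk]
      rw [PowerSeries.coeff_C, if_neg (by omega), aa_rec hc n]
      push_cast
      ring
  have e2 : thet y = PowerSeries.X * (thet (thet y) + thet y + PowerSeries.C (5 / 36) * y) := by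
    ext n
    rcases n with _ | n
    · simp [coeff_thet]
    · rw [PowerSeries.coeff_succ_X_mul, map_add, map_add, coeff_thet, coeff_thet, coeff_thet,
        PowerSeries.coeff_C_mul]
      simp only [hy, PowerSeries.coeff_mk]
      rw [uc]
      have : (n : ℝ) + 1 ≠ 0 := by positivity
      push_cast
      field_simp
      ring
  set D := p * y - PowerSeries.C 4 * thet y with hD
  have e3 : D = 0 := by
    apply D_zero (p := p)
    have e4 : thet D = thet p * y + p * thet y - PowerSeries.C 4 * thet (thet y) := by
      rw [hD, thet_sub, thet_mul, thet_C]
    have c1 : (PowerSeries.C (4 : ℝ)) = 4 := map_ofNat PowerSeries.C 4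
    have c2 : (PowerSeries.C (5 / 9 : ℝ)) = 4 * PowerSeries.C (5 / 36 : ℝ) := by
      rw [← c1, ← map_mul]; norm_num
    have c3 : 4 * (PowerSeries.C (1 / 4 : ℝ)) = 1 := by
      rw [← c1, ← map_mul]; norm_num
    rw [c2] at e1
    rw [e4, hD, c1]
    linear_combination y * e1 - 4 * e2 + PowerSeries.X * p * thet y * c3
  have e5 := congrArg (PowerSeries.coeff X) e3
  rw [hD, map_sub, PowerSeries.coeff_mul, PowerSeries.coeff_C_mul, coeff_thet,
    Finset.Nat.sum_antidiagonal_eq_sum_range_succ_mk] at e5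
  simp only [hp, hy, PowerSeries.coeff_mk, map_zero] at e5
  linarith

/-- normalized coefficients -/
def vc (k : ℕ) : ℝ := uc (k + 1) / (k.factorial : ℝ)

lemma uc_pos (k : ℕ) : 0 < uc k := by
  induction k with
  | zero => simp [uc]
  | succ k ih => rw [uc]; positivity

lemma uc_le (k : ℕ) : uc (k + 1) ≤ k.factorial * (((k : ℝ) + 1) / (k + 2)) := by
  induction k with
  | zero => norm_num [uc]
  | succ k ih =>
    rw [uc, Nat.factorial_succ]
    push_cast
    have h1 := mul_le_mul_of_nonneg_left ih (by positivity :
      0 ≤ ((k : ℝ) + 1 + 1 / 6) * ((k : ℝ) + 1 + 5 / 6) / ((k : ℝ) + 1 + 1))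
    refine h1.trans ?_
    have h2 : ((k : ℝ) + 1 + 1 / 6) * ((k : ℝ) + 1 + 5 / 6) / ((k : ℝ) + 1 + 1) * (((k : ℝ) + 1) / (k + 2))
        ≤ ((k : ℝ) + 1) * (((k : ℝ) + 1 + 1) / (k + 1 + 2)) := by
      rw [div_mul_div_comm, ← mul_div_assoc, div_le_div_iff₀ (by positivity) (by positivity)]
      have hk : (0 : ℝ) ≤ k := Nat.cast_nonneg _
      have : 0 ≤ (k : ℝ) ^ 2 ∧ 0 ≤ (k : ℝ) ^ 3 := ⟨by positivity, by positivity⟩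
      nlinarith
    calc _ = (k.factorial : ℝ) * (((k : ℝ) + 1 + 1 / 6) * ((k : ℝ) + 1 + 5 / 6) / ((k : ℝ) + 1 + 1) * (((k : ℝ) + 1) / (k + 2))) := by ring
      _ ≤ (k.factorial : ℝ) * (((k : ℝ) + 1) * (((k : ℝ) + 1 + 1) / (k + 1 + 2))) :=
        mul_le_mul_of_nonneg_left h2 (by positivity)
      _ = _ := by ring

lemma uc_le' (k : ℕ) : uc (k + 1) ≤ k.factorial := by
  refine (uc_le k).trans ?_
  have : ((k : ℝ) + 1) / (k + 2) ≤ 1 := by rw [div_le_one (by positivity)]; linarith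
  nlinarith [Nat.cast_nonneg (α := ℝ) k.factorial]

lemma uc_prod (n : ℕ) : (∏ j ∈ Finset.range n, ((1 / 6 : ℝ) + j)) * (∏ j ∈ Finset.range n, ((5 / 6 : ℝ) + j))
    = uc n * n.factorial := by
  induction n with
  | zero => simp [uc]
  | succ n ih =>
    rw [Finset.prod_range_succ, Finset.prod_range_succ, uc, Nat.factorial_succ]
    have e : (∏ x ∈ Finset.range n, ((1 / 6 : ℝ) + x)) * (1 / 6 + n) *
        ((∏ x ∈ Finset.range n, ((5 / 6 : ℝ) + x)) * (5 / 6 + n))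
      = ((∏ j ∈ Finset.range n, ((1 / 6 : ℝ) + j)) * (∏ j ∈ Finset.range n, ((5 / 6 : ℝ) + j)))
        * ((1 / 6 + n) * (5 / 6 + n)) := by ring
    rw [e, ih]
    push_cast
    have : (n : ℝ) + 1 ≠ 0 := by positivity
    field_simp
    ring

lemma gammaSeq_prod (n : ℕ) : Real.GammaSeq (1 / 6) n * Real.GammaSeq (5 / 6) n
    = ((n : ℝ) / (n + 1)) / vc n := by
  unfold Real.GammaSeq vc
  rw [div_mul_div_comm, uc_prod, Nat.factorial_succ]
  have h1 : ((n : ℝ) ^ (1 / 6 : ℝ)) * ((n : ℝ) ^ (5 / 6 : ℝ)) = n := by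
    rw [← Real.rpow_add_of_nonneg (Nat.cast_nonneg n) (by norm_num) (by norm_num)]
    norm_num
  have h2 := (uc_pos (n + 1)).ne'
  have h3 : (n.factorial : ℝ) ≠ 0 := by positivity
  have h4 : (n : ℝ) + 1 ≠ 0 := by positivity
  have e : (n : ℝ) ^ (1 / 6 : ℝ) * n.factorial * ((n : ℝ) ^ (5 / 6 : ℝ) * n.factorial)
     = n * (n.factorial * n.factorial) := by
    calc _ = ((n : ℝ) ^ (1 / 6 : ℝ) * (n : ℝ) ^ (5 / 6 : ℝ)) * (n.factorial * n.factorial) := by ring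
      _ = _ := by rw [h1]
  rw [e]
  push_cast
  field_simp

lemma vc_tendsto : Filter.Tendsto vc Filter.atTop (nhds (1 / (2 * Real.pi))) := by
  have h1 := (Real.GammaSeq_tendsto_Gamma (1 / 6)).mul (Real.GammaSeq_tendsto_Gamma (5 / 6))
  have h2 : Real.Gamma (1 / 6) * Real.Gamma (5 / 6) = 2 * Real.pi := by
    have := Real.Gamma_mul_Gamma_one_sub (1 / 6)
    have e : (1 : ℝ) - 1 / 6 = 5 / 6 := by norm_num
    have e2 : Real.pi * (1 / 6) = Real.pi / 6 := by ring
    rw [e, e2, Real.sin_pi_div_six] at this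
    rw [this]; ring
  rw [h2] at h1
  have h3 : Filter.Tendsto (fun n : ℕ => (n : ℝ) / (n + 1)) Filter.atTop (nhds 1) :=
    tendsto_natCast_div_add_atTop 1
  have h4 := h3.div h1 (by positivity)
  refine h4.congr' ?_
  filter_upwards [Filter.eventually_ge_atTop 1] with n hn
  rw [Pi.div_apply, gammaSeq_prod]
  have : (0 : ℝ) < n := by exact_mod_cast hn
  have h5 : vc n ≠ 0 := by unfold vc; have := uc_pos (n + 1); positivity
  field_simp

lemma AA_nonneg (hc : RW c) (X : ℕ) : 0 ≤ AA c (X + 1) := by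
  unfold AA
  rw [← EE_fzero (3 * (X + 1))]
  apply EE_mono
  intro l hl
  exact hc.nonneg (by rintro rfl; simp at hl)

lemma AA_le (hc : RW c) (X : ℕ) : AA c (X + 1) ≤ 8 / 3 := by
  unfold AA
  have h := EE_mono (3 * (X + 1)) c (fun _ => 4 / 3 * 1) (fun l hl => by
    rw [mul_one]; exact hc.le_bound (by rintro rfl; simp at hl))
  rw [EE_smul (3 * (X + 1)) (4 / 3) (fun _ => 1)] at h
  have := EE_one_le (3 * (X + 1))
  linarith

lemma cross_sum (X : ℕ) : ∑ i ∈ Finset.range X, ((i + 1).factorial : ℝ) * ((X - 1 - i).factorial : ℝ)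
    ≤ 2 * (X.factorial : ℝ) := by
  rcases X with _ | X
  · simp
  rw [Finset.sum_range_succ]
  have h1 : ∀ i ∈ Finset.range X, ((i + 1).factorial : ℝ) * ((X + 1 - 1 - i).factorial : ℝ)
      ≤ X.factorial := by
    intro i hi
    rw [Finset.mem_range] at hi
    have h := le_choose (X + 1) (i + 1) (by omega) (by omega)
    have h2 := Nat.choose_mul_factorial_mul_factorial (n := X + 1) (k := i + 1) (by omega)
    have e : X + 1 - (i + 1) = X + 1 - 1 - i := by omega
    rw [e, mul_assoc, Nat.factorial_succ X] at h2
    have h3 : (X + 1) * ((i + 1).factorial * (X + 1 - 1 - i).factorial) ≤ (X + 1) * X.factorial := by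
      rw [← h2]; exact Nat.mul_le_mul_right _ h
    have h4 := Nat.le_of_mul_le_mul_left h3 (by omega)
    exact_mod_cast h4
  have h2 := Finset.sum_le_sum h1
  rw [Finset.sum_const, Finset.card_range, nsmul_eq_mul] at h2
  have e : X + 1 - 1 - X = 0 := by omega
  rw [e]
  have : (0 : ℝ) ≤ X.factorial := by positivity
  refine (add_le_add_left h2 _).trans ?_
  rw [Nat.factorial_succ]
  push_cast
  simp only [Nat.factorial_zero, Nat.cast_one]
  nlinarith [mul_nonneg (Nat.cast_nonneg (α := ℝ) X) this]

lemma AA_sub (hc : RW c) (X : ℕ) : |AA c (X + 1) - 4 * vc X| ≤ (16 / 3) / ((X : ℝ) + 1) := by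
  have h := conv_identity hc (X + 1)
  rw [Finset.sum_range_succ, Finset.sum_range_succ'] at h
  have e0 : aa c 0 = 0 := by simp [aa]
  have e1 : aa c (X + 1) = ((X + 1).factorial : ℝ) * AA c (X + 1) := by simp [aa]
  have e2 : uc (X + 1 - (X + 1)) = 1 := by simp [uc]
  rw [e0, zero_mul, add_zero, e1, e2, mul_one] at h
  set S := ∑ k ∈ Finset.range X, aa c (k + 1) * uc (X + 1 - (k + 1)) with hS
  have hS0 : 0 ≤ S := by
    apply Finset.sum_nonneg
    intro k _
    have := AA_nonneg hc k
    have h2 := uc_pos (X + 1 - (k + 1))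
    simp only [aa]
    rw [if_neg (by omega)]
    positivity
  have hS1 : S ≤ 8 / 3 * (2 * (X.factorial : ℝ)) := by
    refine le_trans ?_ (mul_le_mul_of_nonneg_left (cross_sum X) (by norm_num))
    rw [hS, Finset.mul_sum]
    apply Finset.sum_le_sum
    intro k hk
    rw [Finset.mem_range] at hk
    have b1 := AA_nonneg hc k
    have b2 := AA_le hc k
    have b3 := uc_le' (X - 1 - k)
    have e : X - 1 - k + 1 = X + 1 - (k + 1) := by omega
    rw [e] at b3
    have b4 := uc_pos (X + 1 - (k + 1))
    simp only [aa]
    rw [if_neg (by omega)]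
    calc ((k + 1).factorial : ℝ) * AA c (k + 1) * uc (X + 1 - (k + 1))
        ≤ ((k + 1).factorial : ℝ) * (8 / 3) * ((X - 1 - k).factorial : ℝ) := by gcongr
      _ = _ := by ring
  have hf : (0 : ℝ) < X.factorial := by positivity
  rw [Nat.factorial_succ] at h
  push_cast at h
  have e3 : AA c (X + 1) - 4 * vc X = - S / (((X : ℝ) + 1) * X.factorial) := by
    unfold vc
    have : (X : ℝ) + 1 ≠ 0 := by positivity
    field_simp
    linarith
  rw [e3, abs_div, abs_neg, abs_of_nonneg hS0, abs_of_pos (by positivity : (0 : ℝ) < ((X : ℝ) + 1) * X.factorial),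
    div_le_div_iff₀ (by positivity) (by positivity)]
  have hX : (0 : ℝ) ≤ (X : ℝ) + 1 := by positivity
  nlinarith [mul_le_mul_of_nonneg_right hS1 hX]

lemma AA_tendsto (hc : RW c) : Filter.Tendsto (fun X => AA c (X + 1)) Filter.atTop (nhds (2 / Real.pi)) := by
  have h1 : Filter.Tendsto (fun X => AA c (X + 1) - 4 * vc X) Filter.atTop (nhds 0) := by
    have h2 := (tendsto_one_div_add_atTop_nhds_zero_nat (𝕜 := ℝ)).const_mul (16 / 3)
    rw [mul_zero] at h2
    refine squeeze_zero_norm (fun X => ?_) h2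
    rw [Real.norm_eq_abs, mul_one_div]
    exact AA_sub hc X
  have h3 := h1.add (vc_tendsto.const_mul 4)
  have e : 0 + 4 * (1 / (2 * Real.pi)) = 2 / Real.pi := by
    have := Real.pi_pos.ne'
    field_simp; norm_num
  rw [e] at h3
  simpa using h3

/-- moments of the number of zeros and of the length -/
lemma picks_nz (l : List ℕ) (F : ℕ → ℝ) : ((picks l).map (fun p => (2 * (p.1 : ℝ) + 1) *
    (if p.1 = 0 then F (nz p.2 + 1) else 0))).sum = nz l * F (nz l) := by
  have h : ∀ p ∈ picks l, (2 * (p.1 : ℝ) + 1) * (if p.1 = 0 then F (nz p.2 + 1) else 0)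
      = (if p.1 = 0 then 1 else 0) * F (nz l) := by
    intro p hp
    have hz := nz_perm (picks_perm l p hp)
    by_cases h0 : p.1 = 0
    · rw [if_pos h0, if_pos h0, h0, hz, h0, nz_cons_zero]; simp
    · rw [if_neg h0, if_neg h0]; simp
  rw [list_sum_congr _ _ _ h, List.sum_map_mul_right]
  congr 1
  clear h
  induction l with
  | nil => simp [picks, nz]
  | cons x l ih =>
    simp only [picks, List.map_cons, List.sum_cons, List.map_map]
    have : ((fun p : ℕ × List ℕ => if p.1 = 0 then (1 : ℝ) else 0) ∘ fun p : ℕ × List ℕ => (p.1, x :: p.2))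
        = fun p : ℕ × List ℕ => if p.1 = 0 then (1 : ℝ) else 0 := rfl
    rw [this, ih]
    by_cases hx : x = 0
    · subst hx; rw [nz_cons_zero]; push_cast; ring
    · rw [nz_cons_pos (by omega), if_neg hx, zero_add]

lemma EE_nz (N : ℕ) (F : ℕ → ℝ) {B : ℝ} (hB0 : 0 ≤ B) (hB : ∀ M, EE M (fun l => F (nz l + 1)) ≤ B) :
    EE N (fun l => nz l * F (nz l)) ≤ 2 * B := by
  have e : EE N (fun l => nz l * F (nz l)) = EE N (fun l => ((picks l).map (fun p => (2 * (p.1 : ℝ) + 1) *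
    (fun e s => if e = 0 then F (nz s + 1) else 0) p.1 p.2)).sum) :=
    EE_congr (fun l _ => (picks_nz l F).symm)
  rw [e, EE_palm N (fun e s => if e = 0 then F (nz s + 1) else 0)]
  apply mul_le_mul_of_nonneg_left _ (by norm_num)
  have : ∀ e ∈ od N, EE (N - (2 * e + 1)) (fun s => if e = 0 then F (nz s + 1) else 0)
      = if e = 0 then EE (N - 1) (fun s => F (nz s + 1)) else 0 := by
    intro e _
    split_ifs with h
    · subst h; rfl
    · rw [EE_fzero]
  rw [Finset.sum_congr rfl this, Finset.sum_ite_eq']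
  split_ifs
  · exact hB _
  · exact hB0

lemma EE_z1 (N : ℕ) : EE N (fun l => (nz l : ℝ)) ≤ 4 := by
  have := EE_nz N (fun _ => 1) (B := 2) (by norm_num) EE_one_le
  simp only [mul_one] at this
  linarith

lemma EE_z2 (N : ℕ) : EE N (fun l => (nz l : ℝ) ^ 2) ≤ 12 := by
  have := EE_nz N (fun z => z) (B := 6) (by norm_num) (fun M => by
    push_cast
    rw [EE_add]
    have h1 := EE_z1 M
    have h2 := EE_one_le M
    linarith)
  simp only [← pow_two] at this
  linarith

lemma sum_odd_inv (m : ℕ) : ∑ e ∈ Finset.range m, 1 / (2 * (e : ℝ) + 1) ≤ Real.sqrt m := by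
  induction m with
  | zero => simp
  | succ m ih =>
    rw [Finset.sum_range_succ]
    refine (add_le_add_left ih _).trans ?_
    have h0 : (0 : ℝ) ≤ m := Nat.cast_nonneg m
    have s1 := Real.sq_sqrt h0
    have s2 := Real.sq_sqrt (by positivity : (0 : ℝ) ≤ (m : ℝ) + 1)
    have p1 := Real.sqrt_nonneg (m : ℝ)
    have p2 := Real.sqrt_nonneg ((m : ℝ) + 1)
    have p3 : 1 ≤ Real.sqrt ((m : ℝ) + 1) := Real.one_le_sqrt.2 (by linarith)
    push_cast
    set a := Real.sqrt (m : ℝ)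
    set b := Real.sqrt ((m : ℝ) + 1)
    have hab : a + b ≤ 2 * m + 1 := by
      have hb : b ≤ m + 1 := by nlinarith
      have ha : a ≤ m := by
        rcases Nat.eq_zero_or_pos m with h | h
        · have : (m : ℝ) = 0 := by exact_mod_cast h
          nlinarith
        · have : (1 : ℝ) ≤ m := by exact_mod_cast h
          nlinarith
      linarith
    have : 1 / (2 * (m : ℝ) + 1) ≤ b - a := by
      rw [div_le_iff₀ (by positivity)]
      have hba : 0 ≤ b - a := by nlinarith
      nlinarith
    linarith

lemma picks_len (l : List ℕ) : ((picks l).map (fun p => (2 * (p.1 : ℝ) + 1) *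
    (1 / (2 * (p.1 : ℝ) + 1)))).sum = l.length := by
  have h : ∀ p ∈ picks l, (2 * (p.1 : ℝ) + 1) * (1 / (2 * (p.1 : ℝ) + 1)) = 1 := by
    intro p _
    have : 2 * (p.1 : ℝ) + 1 ≠ 0 := by positivity
    field_simp
  rw [list_sum_congr _ _ _ h]
  have : (picks l).length = l.length := by
    clear h
    induction l with
    | nil => rfl
    | cons x l ih => simp [picks, ih]
  simp [this]

lemma EE_len (N : ℕ) : EE N (fun l => (l.length : ℝ)) ≤ 4 * Real.sqrt (N + 1) := by
  have e : EE N (fun l => (l.length : ℝ)) = EE N (fun l => ((picks l).map (fun p => (2 * (p.1 : ℝ) + 1) *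
    (fun (e : ℕ) (_ : List ℕ) => 1 / (2 * (e : ℝ) + 1)) p.1 p.2)).sum) :=
    EE_congr (fun l _ => (picks_len l).symm)
  rw [e, EE_palm N (fun (e : ℕ) (_ : List ℕ) => 1 / (2 * (e : ℝ) + 1))]
  have h1 : ∀ e ∈ od N, EE (N - (2 * e + 1)) (fun _ => 1 / (2 * (e : ℝ) + 1)) ≤ 2 * (1 / (2 * (e : ℝ) + 1)) := by
    intro e _
    have h := EE_smul (N - (2 * e + 1)) (1 / (2 * (e : ℝ) + 1)) (fun _ => 1)
    simp only [mul_one] at h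
    rw [h, mul_comm]
    exact mul_le_mul_of_nonneg_right (EE_one_le _) (by positivity)
  have h2 := Finset.sum_le_sum h1
  rw [← Finset.mul_sum] at h2
  have h3 := sum_odd_inv ((N + 1) / 2)
  have h4 : Real.sqrt (((N + 1) / 2 : ℕ) : ℝ) ≤ Real.sqrt (N + 1) := by
    apply Real.sqrt_le_sqrt
    exact_mod_cast Nat.div_le_self _ _
  unfold od at h2 ⊢
  linarith

lemma pointwise (hc : RW c) {L : ℝ} (h0 : 0 ≤ L) (h1 : L ≤ 4 / 3)
    (hL : ∀ l : List ℕ, l ≠ [] → (∀ x ∈ l, 1 ≤ x) → ∀ g, 1 ≤ g → Gen l g → |c l - L| ≤ 30000000 / (g : ℝ))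
    {X : ℕ} {l : List ℕ} (hl : wt l = 3 * (X + 1)) :
    |c l - L| ≤ 1 / ((X : ℝ) + 1) * (120000000 * 1 + (8 * (nz l : ℝ) ^ 2 + 3 * (l.length : ℝ))) := by
  have hne : l ≠ [] := by rintro rfl; simp at hl
  rw [one_div_mul_eq_div]
  rcases Nat.lt_or_ge (X + 1) (2 * l.length) with h | h
  · have a1 := hc.nonneg hne
    have a2 := hc.le_bound hne
    have a3 : |c l - L| ≤ 4 / 3 := by rw [abs_le]; constructor <;> linarith
    refine a3.trans ?_
    rw [le_div_iff₀ (by positivity)]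
    have : (X : ℝ) + 1 ≤ 2 * l.length := by exact_mod_cast h.le
    have : 0 ≤ (nz l : ℝ) ^ 2 := by positivity
    linarith
  · have hwt : 2 * l.sum + l.length = 3 * (X + 1) := hl
    obtain ⟨g, hg⟩ : ∃ g, l.sum + 3 = l.length + 3 * g := ⟨(l.sum + 3 - l.length) / 3, by omega⟩
    have hg4 : X + 1 ≤ 4 * g := by omega
    have hg2 : 2 ≤ g := by omega
    have := all_limit hc h0 h1 hL hne hg2 hg
    refine this.trans ?_
    have hgp : (0 : ℝ) < g := by exact_mod_cast (by omega : 0 < g)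
    have hg4' : (X : ℝ) + 1 ≤ 4 * g := by exact_mod_cast hg4
    rw [← add_div, div_le_div_iff₀ hgp (by positivity)]
    have z0 : 0 ≤ 30000000 + 2 * (nz l : ℝ) ^ 2 := by positivity
    have l0 : 0 ≤ 3 * (l.length : ℝ) * g := by positivity
    nlinarith [mul_le_mul_of_nonneg_left hg4' z0]

lemma limit_eq (hc : RW c) {L : ℝ} (h0 : 0 ≤ L) (h1 : L ≤ 4 / 3)
    (hL : ∀ l : List ℕ, l ≠ [] → (∀ x ∈ l, 1 ≤ x) → ∀ g, 1 ≤ g → Gen l g → |c l - L| ≤ 30000000 / (g : ℝ)) :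
    L = 1 / Real.pi := by
  have key : ∀ X : ℕ, |AA c (X + 1) - 2 * L| ≤ 250000000 * (1 / ((X : ℝ) + 1)) + 24 * (1 / Real.sqrt ((X : ℝ) + 1)) := by
    intro X
    set N := 3 * (X + 1) with hN
    have e1 : AA c (X + 1) - 2 * L = EE N (fun l => c l + (- L) * 1) := by
      rw [EE_add, EE_smul N (-L) (fun _ => 1), EE_one, if_neg (by omega)]
      unfold AA; ring
    have e2 : |EE N (fun l => c l + (- L) * 1)| ≤ EE N (fun l => |c l - L|) := by
      rw [abs_le]
      constructor
      · have h := EE_smul N (-1) (fun l => |c l - L|)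
        have : - EE N (fun l => |c l - L|) = EE N (fun l => -1 * |c l - L|) := by rw [h]; ring
        rw [this]
        apply EE_mono
        intro l _
        have := neg_abs_le (c l - L)
        linarith
      · apply EE_mono
        intro l _
        have := le_abs_self (c l - L)
        linarith
    rw [e1]
    refine e2.trans ?_
    refine (EE_mono N _ _ (fun l hl => pointwise hc h0 h1 hL hl)).trans ?_
    rw [EE_smul N (1 / ((X : ℝ) + 1)) (fun l => 120000000 * 1 + (8 * (nz l : ℝ) ^ 2 + 3 * (l.length : ℝ))),
      EE_add, EE_add, EE_smul N 120000000 (fun _ => 1), EE_smul, EE_smul]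
    have b1 := EE_one_le N
    have b2 := EE_z2 N
    have b3 := EE_len N
    have b4 : Real.sqrt ((N : ℝ) + 1) ≤ 2 * Real.sqrt ((X : ℝ) + 1) := by
      have : Real.sqrt (4 * ((X : ℝ) + 1)) = 2 * Real.sqrt ((X : ℝ) + 1) := by
        rw [Real.sqrt_mul (by norm_num)]
        congr 1
        rw [show (4 : ℝ) = 2 ^ 2 by norm_num, Real.sqrt_sq (by norm_num)]
      rw [← this]
      apply Real.sqrt_le_sqrt
      rw [hN]; push_cast
      have : (0 : ℝ) ≤ X := Nat.cast_nonneg X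
      linarith
    have hs : 0 < Real.sqrt ((X : ℝ) + 1) := Real.sqrt_pos.2 (by positivity)
    have hss := Real.mul_self_sqrt (by positivity : (0 : ℝ) ≤ (X : ℝ) + 1)
    have e4 : 1 / Real.sqrt ((X : ℝ) + 1) = 1 / ((X : ℝ) + 1) * Real.sqrt ((X : ℝ) + 1) := by
      have : (X : ℝ) + 1 ≠ 0 := by positivity
      rw [one_div_mul_eq_div, div_eq_div_iff hs.ne' this]
      linarith
    rw [e4, mul_left_comm 24, mul_comm 250000000, ← mul_add]
    apply mul_le_mul_of_nonneg_left _ (by positivity)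
    linarith
  have t1 : Filter.Tendsto (fun X : ℕ => 250000000 * (1 / ((X : ℝ) + 1)) + 24 * (1 / Real.sqrt ((X : ℝ) + 1)))
      Filter.atTop (nhds 0) := by
    have a := tendsto_one_div_add_atTop_nhds_zero_nat (𝕜 := ℝ)
    have b := (Real.continuous_sqrt.tendsto 0).comp a
    rw [Real.sqrt_zero] at b
    have d := (a.const_mul 250000000).add (b.const_mul 24)
    simp only [mul_zero, add_zero] at d
    refine d.congr (fun X => ?_)
    simp
  have t2 : Filter.Tendsto (fun X => AA c (X + 1) - 2 * L) Filter.atTop (nhds 0) :=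
    squeeze_zero_norm (fun X => by rw [Real.norm_eq_abs]; exact key X) t1
  have t3 := tendsto_nhds_unique t2 ((AA_tendsto hc).sub_const (2 * L))
  have : 2 / Real.pi = 2 * (1 / Real.pi) := by ring
  linarith

theorem final (hc : RW c) : ∀ l : List ℕ, l ≠ [] → (∀ x ∈ l, 1 ≤ x) → ∀ g, 1 ≤ g → Gen l g →
    |c l - 1 / Real.pi| ≤ 30000000 / (g : ℝ) := by
  obtain ⟨L, h0, h1, hL⟩ := exists_limit hc
  rw [← limit_eq hc h0 h1 hL]
  exact hL


end Helpers

/-- Uniform large-genus asymptotics `C(d) = 1/π + O(1/g(d))` for primitive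
normalized Witten intersection numbers: there are constants `K > 0` and `g₀ ≥ 1`
such that for every nonempty tuple `d` with all entries `≥ 1` whose `g`-value is
an integer `g ≥ g₀`, one has `|C(d) - 1/π| ≤ K / g`. -/
theorem uniform_asymptotics (C : List ℕ → ℚ) (hC : IsNormalizedWitten C) :
    ∃ K : ℝ, 0 < K ∧ ∃ g₀ : ℕ, 1 ≤ g₀ ∧
      ∀ l : List ℕ, l ≠ [] → (∀ x ∈ l, 1 ≤ x) →
        ∀ g : ℕ, (g : ℚ) = gQ l → g₀ ≤ g →
          |(C l : ℝ) - 1 / Real.pi| ≤ K / (g : ℝ) := by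
  refine ⟨30000000, by norm_num, 1, le_rfl, ?_⟩
  intro l hl hp g hg h1
  refine final (toRW hC) l hl hp g h1 ?_
  unfold gQ at hg
  unfold Gen
  have h2 : (l.sum : ℚ) + 3 = l.length + 3 * g := by rw [hg]; ring
  exact_mod_cast h2

end WittenAsym
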